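/- arXiv:2309.04517 — 2 statements merged into one kernel-verified Lean document; each statement's English description precedes it below -/
import Mathlib

section
/- For every 2-edge-connected graph G on n vertices, the Harary index H(G) is at least H(C_n), with equality if and only if G ≅ C_n. -/
open SimpleGraph Finset

/-- Wiener index: sum of distances over unordered pairs of vertices. -/
noncomputable def wienerIndex {n : ℕ} (G : SimpleGraph (Fin n)) : ℕ :=
  ∑ p ∈ Finset.univ.filter (fun p : Fin n × Fin n => p.1 < p.2), G.dist p.1 p.2

/-- Harary index: sum of reciprocal distances over unordered pairs of vertices. -/
noncomputable def hararyIndex {n : ℕ} (G : SimpleGraph (Fin n)) : ℝ :=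
  ∑ p ∈ Finset.univ.filter (fun p : Fin n × Fin n => p.1 < p.2), (1 : ℝ) / (G.dist p.1 p.2)

/-- A graph is Eulerian if it is connected and every vertex has even degree. -/
def IsEulerian {n : ℕ} (G : SimpleGraph (Fin n)) [DecidableRel G.Adj] : Prop :=
  G.Connected ∧ ∀ v, Even (G.degree v)

/-- A graph is 2-edge-connected if it is connected and remains connected
after the deletion of any single edge. -/
def TwoEdgeConnected {n : ℕ} (G : SimpleGraph (Fin n)) : Prop :=
  G.Connected ∧ ∀ e ∈ G.edgeSet, (G.deleteEdges {e}).Connected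

/-- A graph is 2-connected if it has at least 3 vertices and deleting any
single vertex leaves it connected (no cutvertex). -/
def TwoConnected {n : ℕ} (G : SimpleGraph (Fin n)) : Prop :=
  3 ≤ n ∧ G.Connected ∧
    ∀ v : Fin n, ((⊤ : G.Subgraph).deleteVerts {v}).coe.Connected

/-- The sum `∑ 1/d` over the first `m` vertices other than a fixed one, when every sphere has
two elements. -/
noncomputable def cycleProfile (m : ℕ) : ℝ := ∑ j ∈ range m, (1 : ℝ) / ((j / 2 + 1 : ℕ) : ℝ)

/-- The contribution of the pairs separated by a cut vertex, in the worst case. -/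
noncomputable def crossProfile (a b : ℕ) : ℝ :=
  ∑ i ∈ range a, ∑ j ∈ range b, (1 : ℝ) / ((max 1 i + max 1 j : ℕ) : ℝ)

theorem cycleProfile_succ (m : ℕ) :
    cycleProfile (m + 1) = cycleProfile m + 1 / ((m / 2 + 1 : ℕ) : ℝ) := by
  simp [cycleProfile, sum_range_succ]

theorem crossProfile_comm (a b : ℕ) : crossProfile a b = crossProfile b a := by
  unfold crossProfile
  rw [sum_comm]
  simp only [add_comm]

theorem crossProfile_succ (a b : ℕ) :
    crossProfile a (b + 1) =
      crossProfile a b + ∑ i ∈ range a, (1 : ℝ) / ((max 1 i + max 1 b : ℕ) : ℝ) := by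
  simp [crossProfile, sum_range_succ, sum_add_distrib]

/-- Sum of `a` consecutive reciprocals. -/
noncomputable def recipSum (s a : ℕ) : ℝ := ∑ i ∈ range a, (1 : ℝ) / ((s + i : ℕ) : ℝ)

theorem recipSum_succ (s a : ℕ) : recipSum s (a + 1) = recipSum s a + 1 / ((s + a : ℕ) : ℝ) := by
  simp [recipSum, sum_range_succ]

theorem recipSum_succ' (s a : ℕ) : recipSum s (a + 1) = 1 / (s : ℝ) + recipSum (s + 1) a := by
  unfold recipSum
  rw [sum_range_succ', add_comm]
  simp [add_assoc, add_comm 1]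

theorem sum_max_eq_recipSum (a b : ℕ) (hb : 1 ≤ b) :
    ∑ i ∈ range (a + 1), (1 : ℝ) / ((max 1 i + max 1 b : ℕ) : ℝ) =
      1 / ((b + 1 : ℕ) : ℝ) + recipSum (b + 1) a := by
  rw [sum_range_succ', add_comm, recipSum]
  have h : max 1 b = b := by omega
  congr 1
  · rw [h]; congr 2; simp; omega
  · refine sum_congr rfl fun i _ => ?_
    rw [h]; congr 2; omega

theorem cycleProfile_sub_le (a b : ℕ) :
    cycleProfile (b + a) ≤ cycleProfile b + 2 * recipSum (b + 1) a := by
  induction a with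
  | zero => simp [recipSum]
  | succ a ih =>
    rw [← add_assoc, cycleProfile_succ, recipSum_succ]
    have : (1 : ℝ) / (((b + a) / 2 + 1 : ℕ) : ℝ) ≤ 2 * (1 / ((b + 1 + a : ℕ) : ℝ)) := by
      rw [mul_one_div, div_le_div_iff₀ (by positivity) (by positivity)]
      norm_cast
      omega
    linarith

theorem succ_mul_cycleProfile_add_two (m : ℕ) :
    (m + 3 : ℝ) * cycleProfile (m + 2) =
      (m + 1) * cycleProfile m + cycleProfile (m + 1) + cycleProfile (m + 2) +
        (((m + 1 : ℕ) : ℝ) / ((m / 2 + 1 : ℕ) : ℝ) +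
          ((m + 2 : ℕ) : ℝ) / (((m + 1) / 2 + 1 : ℕ) : ℝ)) := by
  rw [cycleProfile_succ (m + 1), cycleProfile_succ m]
  push_cast
  ring

theorem weight_pair_bounds (m : ℕ) :
    (4 : ℝ) - 2 / (m + 2) ≤ ((m + 1 : ℕ) : ℝ) / ((m / 2 + 1 : ℕ) : ℝ) +
          ((m + 2 : ℕ) : ℝ) / (((m + 1) / 2 + 1 : ℕ) : ℝ) ∧
    ((m + 1 : ℕ) : ℝ) / ((m / 2 + 1 : ℕ) : ℝ) +
          ((m + 2 : ℕ) : ℝ) / (((m + 1) / 2 + 1 : ℕ) : ℝ) ≤ (4 : ℝ) - 2 / (m + 3) := by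
  have hlt : (2 : ℝ) / (m + 3) ≤ 2 / (m + 2) := by gcongr; norm_num
  obtain ⟨k, rfl | rfl⟩ := Nat.even_or_odd' m
  · have h1 : 2 * k / 2 = k := by omega
    have h2 : (2 * k + 1) / 2 = k := by omega
    rw [h1, h2]
    have : ((2 * k + 1 : ℕ) : ℝ) / ((k + 1 : ℕ) : ℝ) + ((2 * k + 2 : ℕ) : ℝ) / ((k + 1 : ℕ) : ℝ)
        = 4 - 2 / ((2 * k : ℕ) + 2) := by
      push_cast; field_simp; ring
    rw [this]
    exact ⟨le_rfl, by linarith⟩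
  · have h1 : (2 * k + 1) / 2 = k := by omega
    have h2 : (2 * k + 1 + 1) / 2 = k + 1 := by omega
    rw [h1, h2]
    have : ((2 * k + 1 + 1 : ℕ) : ℝ) / ((k + 1 : ℕ) : ℝ) +
        ((2 * k + 1 + 2 : ℕ) : ℝ) / ((k + 1 + 1 : ℕ) : ℝ) = 4 - 2 / ((2 * k + 1 : ℕ) + 3) := by
      push_cast; field_simp; ring
    rw [this]
    exact ⟨by linarith, le_rfl⟩

/-- Gluing two cycles of `a + 1` and `b + 1` vertices loses against the cycle of `a + b + 1`
vertices, even with the worst cross contribution. -/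
def GluingBound (a b : ℕ) : Prop :=
  ((a + b : ℕ) + 1 : ℝ) * cycleProfile (a + b) <
    (a + 1) * cycleProfile a + (b + 1) * cycleProfile b + 2 * crossProfile a b

theorem GluingBound.symm {a b : ℕ} (h : GluingBound a b) : GluingBound b a := by
  unfold GluingBound at *
  rw [crossProfile_comm b a, add_comm b a]
  linarith

theorem GluingBound.add_two {a b : ℕ} (ha : 2 ≤ a) (hb : 1 ≤ b) (h : GluingBound a b) :
    GluingBound a (b + 2) := by
  unfold GluingBound at *
  obtain ⟨a, rfl⟩ : ∃ k, a = k + 2 := ⟨a - 2, by omega⟩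
  set s := a + 2 + b with hs
  have e1 := succ_mul_cycleProfile_add_two s
  have e2 := succ_mul_cycleProfile_add_two b
  have w1 := (weight_pair_bounds s).2
  have w2 := (weight_pair_bounds b).1
  have c1 := cycleProfile_sub_le (a + 2) (b + 1)
  have c2 := cycleProfile_sub_le (a + 2) (b + 2)
  rw [show b + 1 + (a + 2) = s + 1 by omega] at c1
  rw [show b + 2 + (a + 2) = s + 2 by omega] at c2
  rw [show a + 2 + (b + 2) = s + 2 by omega, show b + 2 = b + 1 + 1 from rfl,
    crossProfile_succ, crossProfile_succ, sum_max_eq_recipSum _ _ hb,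
    sum_max_eq_recipSum _ _ (by omega)]
  have t1 := recipSum_succ' (b + 1) a
  have t2 := recipSum_succ' (b + 1 + 1) a
  have t3 := recipSum_succ (b + 1 + 1) (a + 1)
  have t4 := recipSum_succ (b + 1 + 1) a
  have t5 := recipSum_succ (b + 2 + 1) (a + 1)
  have t6 := recipSum_succ (b + 2 + 1) a
  have key : (1 : ℝ) / (s : ℝ) + 2 / (s + 1) + 1 / (s + 2) + 1 / (b + 2) - 1 / (s + 3) <
      2 / (b + 1) + 2 / (b + 2) := by
    have hsb : (b : ℝ) + 2 ≤ s := by rw [hs]; push_cast; linarith [(Nat.cast_nonneg a : (0:ℝ) ≤ a)]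
    have hb0 : (0 : ℝ) ≤ b := by positivity
    have k1 : (1 : ℝ) / s ≤ 1 / (b + 2) := by gcongr
    have k2 : (2 : ℝ) / (s + 1) ≤ 2 / (b + 3) := by
      apply div_le_div_of_nonneg_left <;> linarith
    have k3 : (1 : ℝ) / (s + 2) - 1 / (s + 3) ≤ 1 / ((b + 4) * (b + 5)) := by
      have : (1 : ℝ) / (s + 2) - 1 / (s + 3) = 1 / ((s + 2) * (s + 3)) := by
        field_simp; ring
      rw [this]
      gcongr ?_ / (?_ * ?_) <;> linarith
    have k4 : (1 : ℝ) / ((b + 4) * (b + 5)) < 2 / (b + 1) - 2 / (b + 3) := by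
      have : (2 : ℝ) / (b + 1) - 2 / (b + 3) = 4 / ((b + 1) * (b + 3)) := by
        field_simp; ring
      rw [this]
      gcongr ?_ / (?_ * ?_) <;> linarith
    have k5 : (2 : ℝ) / (b + 2) = 1 / (b + 2) + 1 / (b + 2) := by ring
    linarith
  have hsc : (s : ℝ) = a + 2 + b := by rw [hs]; push_cast; ring
  have m1 : (2 : ℝ) / (s + 3) = 2 * (1 / (s + 3)) := by ring
  have m2 : (2 : ℝ) / (b + 2) = 2 * (1 / (b + 2)) := by ring
  have m3 : (2 : ℝ) / (b + 1) = 2 * (1 / (b + 1)) := by ring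
  have m4 : (2 : ℝ) / (s + 1) = 2 * (1 / (s + 1)) := by ring
  have f1 : ((b + 1 + 1 + (a + 1) : ℕ) : ℝ) = s + 1 := by push_cast; linarith
  have f2 : ((b + 1 + 1 + a : ℕ) : ℝ) = s := by push_cast; linarith
  have f3 : ((b + 2 + 1 + (a + 1) : ℕ) : ℝ) = s + 2 := by push_cast; linarith
  have f4 : ((b + 2 + 1 + a : ℕ) : ℝ) = s + 1 := by push_cast; linarith
  have f5 : ((b + 1 + 1 : ℕ) : ℝ) = b + 2 := by push_cast; ring
  have f6 : ((b + 1 : ℕ) : ℝ) = b + 1 := by push_cast; ring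
  have f7 : ((b + 2 : ℕ) : ℝ) = b + 2 := by push_cast; ring
  have f8 : ((s + 2 : ℕ) : ℝ) = s + 2 := by push_cast; ring
  rw [f1] at t3
  rw [f2] at t4
  rw [f3] at t5
  rw [f4] at t6
  rw [f6] at t1
  rw [f5] at t2
  simp only [show b + 1 + 1 = b + 2 from rfl] at *
  rw [f8, f7, f6]
  rw [m1] at w1
  rw [m2] at w2
  rw [m2, m3, m4] at key
  have e1' : ((s : ℝ) + 2 + 1) * cycleProfile (s + 2) = (s + 3) * cycleProfile (s + 2) := by ring
  have e2' : ((b : ℝ) + 2 + 1) * cycleProfile (b + 2) = (b + 3) * cycleProfile (b + 2) := by ring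
  rw [e1', e2', e1, e2]
  linarith

theorem gluingBound {a b : ℕ} (ha : 2 ≤ a) (hb : 2 ≤ b) : GluingBound a b := by
  have step : ∀ a, 2 ≤ a → GluingBound a 2 → GluingBound a 3 → ∀ b, GluingBound a (b + 2) := by
    intro a ha h2 h3 b
    induction b using Nat.twoStepInduction with
    | zero => exact h2
    | one => exact h3
    | more b ih _ => exact ih.add_two ha (by omega)
  have h22 : GluingBound 2 2 := by
    norm_num [GluingBound, cycleProfile, crossProfile, sum_range_succ]
  have h23 : GluingBound 2 3 := by
    norm_num [GluingBound, cycleProfile, crossProfile, sum_range_succ]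
  have h33 : GluingBound 3 3 := by
    norm_num [GluingBound, cycleProfile, crossProfile, sum_range_succ]
  obtain ⟨a, rfl⟩ : ∃ k, a = k + 2 := ⟨a - 2, by omega⟩
  obtain ⟨b, rfl⟩ : ∃ k, b = k + 2 := ⟨b - 2, by omega⟩
  exact step _ ha (step 2 le_rfl h22 h23 a).symm (step 3 (by omega) h23.symm h33 a).symm b

theorem exists_equiv_monotone {V : Type*} (s : Finset V) (d : V → ℕ) :
    ∃ e : Fin #s ≃ s, Monotone fun j => d (e j) :=
  ⟨(Tuple.sort fun j => d (s.equivFin.symm j)).trans s.equivFin.symm,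
    Tuple.monotone_sort fun j => d (s.equivFin.symm j)⟩

theorem sum_comp_equiv_fin {V : Type*} {s : Finset V} (e : Fin #s ≃ s) (f : V → ℝ) :
    ∑ x ∈ s, f x = ∑ j : Fin #s, f (e j) := by
  rw [← Finset.sum_coe_sort s f, ← e.sum_comp]

theorem exists_equiv_le {V : Type*} {s : Finset V} {d : V → ℕ} {g : ℕ → ℕ}
    (h : ∀ j < #s, j + 1 ≤ #{x ∈ s | d x ≤ g j}) :
    ∃ e : Fin #s ≃ s, ∀ j : Fin #s, d (e j) ≤ g j := by
  obtain ⟨e, he⟩ := exists_equiv_monotone s d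
  refine ⟨e, fun j => ?_⟩
  by_contra! hj
  have : #{x ∈ s | d x ≤ g j} ≤ #(range j) := by
    refine card_le_card_of_surjOn
      (fun i => if hi : i < #s then (e ⟨i, hi⟩ : V) else (e j : V)) ?_
    intro x hx
    simp only [coe_filter, Set.mem_ofPred_eq] at hx
    refine ⟨e.symm ⟨x, hx.1⟩, ?_, by simp⟩
    rw [coe_range, Set.mem_Iio]
    by_contra! hle
    have := he (show j ≤ e.symm ⟨x, hx.1⟩ from hle)
    simp at this
    omega
  have := h j j.2
  simp at *
  omega

theorem sum_one_div_ge {V : Type*} {s : Finset V} {d : V → ℕ} {g : ℕ → ℕ}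
    (hd : ∀ x ∈ s, 0 < d x) (h : ∀ j < #s, j + 1 ≤ #{x ∈ s | d x ≤ g j}) :
    ∑ j ∈ range #s, (1 : ℝ) / (g j : ℝ) ≤ ∑ x ∈ s, (1 : ℝ) / (d x : ℝ) := by
  obtain ⟨e, he⟩ := exists_equiv_le h
  rw [sum_comp_equiv_fin e, ← Fin.sum_univ_eq_sum_range fun j => (1 : ℝ) / (g j : ℝ)]
  refine sum_le_sum fun j _ => ?_
  have := hd _ (e j).2
  gcongr
  exact he j

theorem sum_one_div_le_cycleProfile {V : Type*} {s : Finset V} {d : V → ℕ}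
    (h : ∀ k, #{x ∈ s | d x ≤ k} ≤ 2 * k) :
    ∑ x ∈ s, (1 : ℝ) / (d x : ℝ) ≤ cycleProfile #s := by
  obtain ⟨e, he⟩ := exists_equiv_monotone s d
  rw [sum_comp_equiv_fin e, cycleProfile,
    ← Fin.sum_univ_eq_sum_range fun j => (1 : ℝ) / ((j / 2 + 1 : ℕ) : ℝ)]
  refine sum_le_sum fun j _ => ?_
  have hle : #(Finset.Iic j) ≤ #{x ∈ s | d x ≤ d (e j)} := by
    refine card_le_card_of_injOn (fun i => (e i : V)) ?_ ?_
    · intro i hi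
      simp only [coe_filter, Set.mem_ofPred_eq]
      exact ⟨(e i).2, he (by simpa using hi)⟩
    · intro i _ i' _ hii
      exact e.injective (Subtype.ext hii)
  have := h (d (e j))
  rw [Fin.card_Iic] at hle
  gcongr
  omega

theorem crossProfile_le {V : Type*} {s t : Finset V} {d : V → ℕ}
    (hs : ∀ j < #s, j + 1 ≤ #{x ∈ s | d x ≤ max 1 j})
    (ht : ∀ j < #t, j + 1 ≤ #{x ∈ t | d x ≤ max 1 j})
    (hds : ∀ x ∈ s, 0 < d x) :
    crossProfile #s #t ≤ ∑ x ∈ s, ∑ y ∈ t, (1 : ℝ) / ((d x + d y : ℕ) : ℝ) := by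
  obtain ⟨e, he⟩ := exists_equiv_le (g := fun j => max 1 j) hs
  obtain ⟨e', he'⟩ := exists_equiv_le (g := fun j => max 1 j) ht
  rw [sum_comp_equiv_fin e, crossProfile, ← Fin.sum_univ_eq_sum_range
    fun i => ∑ j ∈ range #t, (1 : ℝ) / ((max 1 i + max 1 j : ℕ) : ℝ)]
  refine sum_le_sum fun i _ => ?_
  rw [sum_comp_equiv_fin e', ← Fin.sum_univ_eq_sum_range
    fun j => (1 : ℝ) / ((max 1 (i : ℕ) + max 1 j : ℕ) : ℝ)]
  refine sum_le_sum fun j _ => ?_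
  have := hds _ (e i).2
  have h1 := he i
  have h2 := he' j
  apply one_div_le_one_div_of_le
  · exact_mod_cast (by omega)
  · exact_mod_cast (by omega)

namespace SimpleGraph

variable {V : Type*} {G : SimpleGraph V}

theorem Connected.exists_adj_dist_eq (hG : G.Connected) {u x : V} {m : ℕ}
    (h : G.dist u x = m + 1) : ∃ y, G.Adj y x ∧ G.dist u y = m := by
  obtain ⟨p, hp⟩ := hG.exists_walk_length_eq_dist x u
  rw [dist_comm, h] at hp
  cases p with
  | nil => simp at hp
  | @cons _ y _ hxy q =>
    refine ⟨y, hxy.symm, ?_⟩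
    have h1 : G.dist y u ≤ q.length := dist_le q
    have h2 := hG.dist_triangle (u := u) (v := y) (w := x)
    rw [dist_eq_one_iff_adj.mpr hxy.symm, h] at h2
    rw [dist_comm] at h1
    simp at hp
    omega

theorem Connected.exists_dist_eq (hG : G.Connected) {u x : V} {m : ℕ}
    (h : m ≤ G.dist u x) : ∃ y, G.dist u y = m := by
  obtain ⟨k, hk⟩ := Nat.exists_eq_add_of_le h
  induction k generalizing x with
  | zero => exact ⟨x, by simpa using hk⟩
  | succ k ih =>
    obtain ⟨y, -, hy⟩ := hG.exists_adj_dist_eq (u := u) (x := x) (m := m + k) (by omega)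
    exact ih (by omega) hy

theorem Connected.dist_le_succ (hG : G.Connected) {u x y : V} (h : G.Adj x y) :
    G.dist u y ≤ G.dist u x + 1 := by
  have := hG.dist_triangle (u := u) (v := x) (w := y)
  rwa [dist_eq_one_iff_adj.mpr h] at this

/-- Connected, and still connected after the deletion of any single edge. -/
def IsBridgelessConnected (G : SimpleGraph V) : Prop :=
  G.Connected ∧ ∀ e, (G.deleteEdges {e}).Connected

theorem Connected.induce_of_cut (hG : G.Connected) {S : Set V} {v : V} (hv : v ∈ S)
    (hS : ∀ a ∈ S, a ≠ v → ∀ b ∉ S, ¬G.Adj a b) : (G.induce S).Connected := by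
  have key : ∀ (x w : V) (_ : G.Walk x w) (hx : x ∈ S) (_ : w = v),
      (G.induce S).Reachable ⟨x, hx⟩ ⟨v, hv⟩ := by
    intro x w p
    induction p with
    | nil => rintro hx rfl; rfl
    | @cons x y w hxy p ih =>
      intro hx hw
      by_cases hxv : x = v
      · subst hxv; rfl
      · have hy : y ∈ S := by
          by_contra hy
          exact hS x hx hxv y hy hxy
        have hadj : (G.induce S).Adj ⟨x, hx⟩ ⟨y, hy⟩ := hxy
        exact hadj.reachable.trans (ih hy hw)
  have : Nonempty S := ⟨⟨v, hv⟩⟩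
  refine Connected.mk fun x y => ?_
  obtain ⟨p⟩ := hG.preconnected x v
  obtain ⟨q⟩ := hG.preconnected y v
  exact (key x v p x.2 rfl).trans (key y v q y.2 rfl).symm

theorem IsBridgelessConnected.induce_of_cut (hG : G.IsBridgelessConnected) {S : Set V} {v : V}
    (hv : v ∈ S) (hS : ∀ a ∈ S, a ≠ v → ∀ b ∉ S, ¬G.Adj a b) :
    (G.induce S).IsBridgelessConnected := by
  refine ⟨hG.1.induce_of_cut hv hS, fun e => ?_⟩
  refine Connected.mono ?_ ((hG.2 (e.map Subtype.val)).induce_of_cut hv ?_)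
  · intro x y hxy
    simp only [comap_adj, Function.Embedding.subtype_apply, deleteEdges_adj,
      Set.mem_singleton_iff] at hxy ⊢
    refine ⟨hxy.1, ?_⟩
    rintro rfl
    exact hxy.2 rfl
  · intro a ha hav b hb hab
    exact hS a ha hav b hb (deleteEdges_adj.mp hab).1

theorem IsBridgelessConnected.exists_two_adj [Nontrivial V] (hG : G.IsBridgelessConnected)
    (v : V) : ∃ w w', w ≠ w' ∧ G.Adj v w ∧ G.Adj v w' := by
  obtain ⟨w, hw⟩ := hG.1.preconnected.exists_adj_of_nontrivial v
  obtain ⟨w', hw'⟩ := (hG.2 s(v, w)).preconnected.exists_adj_of_nontrivial v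
  rw [deleteEdges_adj] at hw'
  refine ⟨w, w', ?_, hw, hw'.1⟩
  rintro rfl
  exact hw'.2 rfl

theorem dist_le_dist_induce {S : Set V} (hS : (G.induce S).Connected) (x y : S) :
    G.dist x y ≤ (G.induce S).dist x y := by
  obtain ⟨p, hp⟩ := hS.exists_walk_length_eq_dist x y
  rw [← hp, ← Walk.length_map (Embedding.induce (G := G) S).toHom p]
  exact dist_le _

section Fintype

variable [Fintype V] [DecidableEq V]

theorem card_ball_succ (u : V) (k : ℕ) :
    #{x ∈ univ.erase u | G.dist u x ≤ k + 1} =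
      #{x ∈ univ.erase u | G.dist u x ≤ k} + #{x ∈ univ.erase u | G.dist u x = k + 1} := by
  rw [← card_union_of_disjoint]
  · congr 1
    ext x
    simp only [mem_filter, mem_union]
    grind
  · rw [Finset.disjoint_left]
    simp only [mem_filter]
    grind

theorem card_ball_of_forall_le {u : V} {k : ℕ} (h : ∀ x, G.dist u x ≤ k) :
    #{x ∈ univ.erase u | G.dist u x ≤ k} = Fintype.card V - 1 := by
  rw [filter_true_of_mem fun x _ => h x, card_erase_of_mem (mem_univ u), card_univ]

/-- `v` separates the nonempty set `A` from the nonempty rest of the vertices. -/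
def IsSeparation (G : SimpleGraph V) (v : V) (A : Finset V) : Prop :=
  v ∉ A ∧ A.Nonempty ∧ (∃ b, b ∉ A ∧ b ≠ v) ∧ ∀ a ∈ A, ∀ b ∉ A, b ≠ v → ¬G.Adj a b

theorem Connected.two_mul_le_card_ball (hG : G.Connected)
    (hsep : ∀ v A, ¬G.IsSeparation v A) (u : V) (k : ℕ) :
    min (2 * k) (Fintype.card V - 1) ≤ #{x ∈ univ.erase u | G.dist u x ≤ k} := by
  induction k with
  | zero => simp
  | succ k ih =>
    by_cases hall : ∀ x, G.dist u x ≤ k + 1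
    · rw [card_ball_of_forall_le hall]
      exact min_le_right _ _
    · push Not at hall
      obtain ⟨x, hx⟩ := hall
      obtain ⟨w, hw⟩ := hG.exists_dist_eq hx.le
      have h2 : ∃ w', w' ≠ w ∧ G.dist u w' = k + 1 := by
        by_contra! hno
        refine hsep w {y | G.dist u y ≤ k} ⟨by simp [hw], ⟨u, by simp⟩, ⟨x, ?_, ?_⟩, ?_⟩
        · simp; omega
        · rintro rfl; omega
        · intro a ha b hb hbw hab
          have := hG.dist_le_succ (u := u) hab
          have := hno b hbw
          simp at ha hb
          omega
      obtain ⟨w', hne, hw'⟩ := h2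
      have hcard : 2 ≤ #{x ∈ univ.erase u | G.dist u x = k + 1} := by
        rw [← card_pair hne]
        refine card_le_card fun y hy => ?_
        have hu : G.dist u u = 0 := dist_self
        simp only [mem_insert, mem_singleton] at hy
        simp only [mem_filter, mem_erase, mem_univ, and_true]
        rcases hy with rfl | rfl
        · exact ⟨by rintro rfl; omega, hw'⟩
        · exact ⟨by rintro rfl; omega, hw⟩
      rw [card_ball_succ]
      omega

theorem IsBridgelessConnected.succ_le_card_ball [Nontrivial V] (hG : G.IsBridgelessConnected)
    (u : V) (k : ℕ) :
    min (k + 2) (Fintype.card V - 1) ≤ #{x ∈ univ.erase u | G.dist u x ≤ k + 1} := by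
  induction k with
  | zero =>
    obtain ⟨w, w', hne, hw, hw'⟩ := hG.exists_two_adj u
    refine (min_le_left _ _).trans ?_
    rw [zero_add, ← card_pair hne]
    refine card_le_card fun y hy => ?_
    simp only [mem_insert, mem_singleton] at hy
    simp only [mem_filter, mem_erase, mem_univ, and_true]
    rcases hy with rfl | rfl
    · exact ⟨hw.ne', (dist_eq_one_iff_adj.mpr hw).le⟩
    · exact ⟨hw'.ne', (dist_eq_one_iff_adj.mpr hw').le⟩
  | succ k ih =>
    by_cases hall : ∀ x, G.dist u x ≤ k + 1 + 1
    · rw [card_ball_of_forall_le hall]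
      exact min_le_right _ _
    · push Not at hall
      obtain ⟨x, hx⟩ := hall
      obtain ⟨w, hw⟩ := hG.1.exists_dist_eq hx.le
      have hcard : 1 ≤ #{x ∈ univ.erase u | G.dist u x = k + 1 + 1} := by
        refine card_pos.mpr ⟨w, ?_⟩
        simp only [mem_filter, mem_erase, mem_univ, and_true]
        refine ⟨?_, hw⟩
        rintro rfl
        simp at hw
      rw [card_ball_succ]
      omega

theorem coe_sphere_one (u : V) :
    ((univ.erase u).filter fun x => G.dist u x = 1 : Finset V) = G.neighborSet u := by
  ext x
  simp only [coe_filter, mem_erase, mem_univ, and_true, Set.mem_ofPred_eq, mem_neighborSet,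
    dist_eq_one_iff_adj]
  exact ⟨fun h => h.2, fun h => ⟨h.ne', h⟩⟩

theorem card_sphere_one (u : V) :
    #{x ∈ univ.erase u | G.dist u x = 1} = (G.neighborSet u).ncard := by
  rw [← coe_sphere_one, Set.ncard_coe_finset]

theorem Connected.card_sphere_le_two (hG : G.Connected)
    (hdeg : ∀ v, (G.neighborSet v).ncard ≤ 2) (u : V) (k : ℕ) :
    #{x ∈ univ.erase u | G.dist u x = k + 1} ≤ 2 := by
  induction k with
  | zero =>
    rw [zero_add, card_sphere_one]
    exact hdeg u
  | succ k ih =>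
    refine le_trans ?_ ih
    have hpred : ∀ x, ∃ y, G.dist u x = k + 1 + 1 → G.Adj y x ∧ G.dist u y = k + 1 := by
      intro x
      by_cases hx : G.dist u x = k + 1 + 1
      · obtain ⟨y, hy⟩ := hG.exists_adj_dist_eq hx
        exact ⟨y, fun _ => hy⟩
      · exact ⟨x, fun h => absurd h hx⟩
    choose p hp using hpred
    refine card_le_card_of_injOn p ?_ ?_
    · intro x hx
      simp only [coe_filter, mem_erase, mem_univ, and_true, Set.mem_ofPred_eq] at hx ⊢
      have := (hp x hx.2).2
      refine ⟨?_, this⟩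
      intro h
      rw [h] at this
      simp at this
    · intro x hx x' hx' hxx
      simp only [coe_filter, mem_erase, mem_univ, and_true, Set.mem_ofPred_eq] at hx hx'
      by_contra hne
      obtain ⟨z, hz, hzd⟩ := hG.exists_adj_dist_eq (hp x hx.2).2
      have h1 : z ≠ x := by rintro rfl; omega
      have h2 : z ≠ x' := by rintro rfl; omega
      have hsub : (({z, x, x'} : Finset V) : Set V) ⊆ G.neighborSet (p x) := by
        intro t ht
        simp only [coe_insert, coe_singleton, Set.mem_insert_iff, Set.mem_singleton_iff] at ht
        rcases ht with rfl | rfl | rfl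
        · exact hz.symm
        · exact (hp _ hx.2).1
        · rw [hxx]; exact (hp _ hx'.2).1
      have h3 := Set.ncard_le_ncard hsub (Set.toFinite _)
      rw [Set.ncard_coe_finset, card_eq_three.mpr ⟨z, x, x', h1, h2, hne, rfl⟩] at h3
      have := hdeg (p x)
      omega

theorem Connected.card_ball_le_two_mul (hG : G.Connected)
    (hdeg : ∀ v, (G.neighborSet v).ncard ≤ 2) (u : V) (k : ℕ) :
    #{x ∈ univ.erase u | G.dist u x ≤ k} ≤ 2 * k := by
  induction k with
  | zero =>
    rw [mul_zero, Nat.le_zero, card_eq_zero, filter_eq_empty_iff]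
    intro x hx
    have := hG.pos_dist_of_ne (ne_of_mem_erase hx).symm
    omega
  | succ k ih =>
    rw [card_ball_succ]
    have := hG.card_sphere_le_two hdeg u k
    omega

/-- The sum of the reciprocal distances from `u` to the other vertices. -/
noncomputable def recipTransmission (G : SimpleGraph V) (u : V) : ℝ :=
  ∑ v, (1 : ℝ) / (G.dist u v : ℝ)

theorem recipTransmission_eq (u : V) :
    G.recipTransmission u = ∑ v ∈ univ.erase u, (1 : ℝ) / (G.dist u v : ℝ) := by
  rw [recipTransmission, ← add_sum_erase _ _ (mem_univ u)]
  simp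

theorem Connected.recipTransmission_le (hG : G.Connected)
    (hdeg : ∀ v, (G.neighborSet v).ncard ≤ 2) (u : V) :
    G.recipTransmission u ≤ cycleProfile (Fintype.card V - 1) := by
  rw [recipTransmission_eq]
  convert sum_one_div_le_cycleProfile (hG.card_ball_le_two_mul hdeg u)
  simp

theorem Connected.cycleProfile_le_recipTransmission (hG : G.Connected)
    (hsep : ∀ v A, ¬G.IsSeparation v A) (u : V) :
    cycleProfile (Fintype.card V - 1) ≤ G.recipTransmission u := by
  rw [recipTransmission_eq]
  have hcard : #(univ.erase u) = Fintype.card V - 1 := by simp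
  rw [← hcard, cycleProfile]
  refine sum_one_div_ge (fun x hx => hG.pos_dist_of_ne (ne_of_mem_erase hx).symm) fun j hj => ?_
  have := hG.two_mul_le_card_ball hsep u (j / 2 + 1)
  omega

theorem Connected.cycleProfile_lt_recipTransmission (hG : G.Connected)
    (hsep : ∀ v A, ¬G.IsSeparation v A) {u : V} (hu : 2 < (G.neighborSet u).ncard) :
    cycleProfile (Fintype.card V - 1) < G.recipTransmission u := by
  rw [recipTransmission_eq]
  have hcard : #(univ.erase u) = Fintype.card V - 1 := by simp
  rw [← card_sphere_one] at hu
  have h3 : 2 < #(univ.erase u) := hu.trans_le (card_le_card (filter_subset _ _))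
  rw [← hcard, cycleProfile]
  refine lt_of_lt_of_le ?_ (sum_one_div_ge (g := fun j => if j = 2 then 1 else j / 2 + 1)
    (fun x hx => hG.pos_dist_of_ne (ne_of_mem_erase hx).symm) fun j hj => ?_)
  · refine sum_lt_sum (fun j _ => ?_) ⟨2, mem_range.mpr h3, by norm_num⟩
    split_ifs with hj
    · subst hj; norm_num
    · exact le_rfl
  · split_ifs with h
    · subst h
      exact hu.trans_le (card_le_card fun x hx => by
        rw [mem_filter] at hx ⊢; exact ⟨hx.1, hx.2.le⟩)
    · have := hG.two_mul_le_card_ball hsep u (j / 2 + 1)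
      omega

end Fintype

end SimpleGraph

namespace SimpleGraph

section Induction

variable {V : Type*} [Fintype V] [DecidableEq V] {G : SimpleGraph V}

theorem IsSeparation.compl {v : V} {A : Finset V} (h : G.IsSeparation v A) :
    G.IsSeparation v (Aᶜ.erase v) := by
  obtain ⟨hv, ⟨a, ha⟩, ⟨b, hb, hbv⟩, hadj⟩ := h
  refine ⟨by simp, ⟨b, by simp [hb, hbv]⟩, ⟨a, by simp [ha], ?_⟩, ?_⟩
  · rintro rfl; exact hv ha
  · intro x hx y hy hyv hxy
    simp only [mem_erase, mem_compl, not_and, not_not] at hx hy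
    exact hadj y (hy hyv) x hx.2 hx.1 hxy.symm

omit [Fintype V] in
theorem IsSeparation.isBridgelessConnected_induce (hG : G.IsBridgelessConnected) {v : V}
    {A : Finset V} (h : G.IsSeparation v A) :
    (G.induce (insert v A : Finset V)).IsBridgelessConnected := by
  refine hG.induce_of_cut (v := v) (by simp) ?_
  intro a ha hav b hb
  simp only [coe_insert, Set.mem_insert_iff, mem_coe, not_or] at ha hb
  exact h.2.2.2 a (ha.resolve_left hav) b hb.2 hb.1

omit [Fintype V] in
theorem IsSeparation.nontrivial_insert {v : V} {A : Finset V} (h : G.IsSeparation v A) :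
    Nontrivial ((insert v A : Finset V) : Set V) := by
  obtain ⟨a, ha⟩ := h.2.1
  exact Set.nontrivial_coe_sort.mpr
    ⟨v, by simp, a, by simp [ha], fun hva => h.1 (hva ▸ ha)⟩

theorem IsSeparation.two_le_card (hG : G.IsBridgelessConnected) {v : V}
    {A : Finset V} (h : G.IsSeparation v A) : 2 ≤ #A := by
  have := h.nontrivial_insert
  obtain ⟨w, w', hne, hw, hw'⟩ :=
    (h.isBridgelessConnected_induce hG).exists_two_adj ⟨v, by simp⟩
  rw [← card_pair (Subtype.coe_ne_coe.mpr hne)]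
  refine card_le_card fun x hx => ?_
  have hmem : ∀ y : ((insert v A : Finset V) : Set V), (y : V) ≠ v → (y : V) ∈ A := fun y hy =>
    (mem_insert.mp y.2).resolve_left hy
  rcases mem_insert.mp hx with rfl | hx
  · exact hmem w (Subtype.coe_ne_coe.mpr hw.ne')
  · rw [mem_singleton.mp hx]
    exact hmem w' (Subtype.coe_ne_coe.mpr hw'.ne')

theorem IsSeparation.succ_le_card_filter (hG : G.IsBridgelessConnected) {v : V}
    {A : Finset V} (h : G.IsSeparation v A) (j : ℕ) (hj : j < #A) :
    j + 1 ≤ #{x ∈ A | G.dist v x ≤ max 1 j} := by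
  have hb := h.isBridgelessConnected_induce hG
  set S : Set V := ((insert v A : Finset V) : Set V) with hS
  have hvS : v ∈ S := by simp [hS]
  have : Nontrivial S := h.nontrivial_insert
  have hcard : Fintype.card S - 1 = #A := by
    simp only [hS, Fintype.card_coe, coe_sort_coe, card_insert_of_notMem h.1]
    omega
  obtain ⟨k, hk, hkj⟩ : ∃ k, k + 1 = max 1 j ∧ j + 1 ≤ k + 2 := ⟨max 1 j - 1, by omega, by omega⟩
  have h1 := hb.succ_le_card_ball ⟨v, hvS⟩ k
  have h2 : #{x ∈ univ.erase (⟨v, hvS⟩ : S) | (G.induce S).dist ⟨v, hvS⟩ x ≤ k + 1} ≤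
      #{x ∈ A | G.dist v x ≤ max 1 j} := by
    refine card_le_card_of_injOn Subtype.val ?_ Subtype.val_injective.injOn
    intro x hx
    simp only [coe_filter, mem_erase, mem_univ, and_true, Set.mem_ofPred_eq] at hx ⊢
    have hxS : (x : V) ∈ insert v A := x.2
    refine ⟨(mem_insert.mp hxS).resolve_left fun hxv => hx.1 (Subtype.ext hxv), ?_⟩
    have := dist_le_dist_induce hb.1 ⟨v, hvS⟩ x
    exact hk ▸ this.trans hx.2
  omega

omit [Fintype V] in
theorem Connected.sum_recipTransmission_induce_le (hG : G.Connected) {s : Finset V}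
    (hs : (G.induce (s : Set V)).Connected) :
    ∑ x, (G.induce (s : Set V)).recipTransmission x ≤
      ∑ x ∈ s, ∑ y ∈ s, (1 : ℝ) / (G.dist x y : ℝ) := by
  rw [← sum_finset_coe _ s]
  refine sum_le_sum fun x _ => ?_
  rw [recipTransmission, ← sum_finset_coe _ s]
  refine sum_le_sum fun y _ => ?_
  by_cases hxy : x = y
  · simp [hxy]
  · have h0 := hG.pos_dist_of_ne (Subtype.coe_ne_coe.mpr hxy)
    have h1 := dist_le_dist_induce hs x y
    gcongr

theorem sum_sum_eq_of_cut {f : V → V → ℝ} (hf : ∀ x y, f x y = f y x) (hf0 : ∀ x, f x x = 0)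
    {v : V} {A B : Finset V} (hA : v ∉ A) (hB : B = Aᶜ.erase v) :
    ∑ x, ∑ y, f x y = ∑ x ∈ insert v A, ∑ y ∈ insert v A, f x y +
      ∑ x ∈ insert v B, ∑ y ∈ insert v B, f x y + 2 * ∑ x ∈ A, ∑ y ∈ B, f x y := by
  have hvB : v ∉ B := by simp [hB]
  have huniv : ∀ g : V → ℝ, ∑ x, g x = ∑ x ∈ A, g x + (g v + ∑ x ∈ B, g x) := by
    intro g
    rw [hB, add_sum_erase _ _ (by simpa using hA), sum_add_sum_compl]
  have e1 : ∑ x ∈ B, ∑ y ∈ A, f x y = ∑ x ∈ A, ∑ y ∈ B, f x y := by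
    rw [sum_comm]
    simp only [hf]
  have e2 : ∀ s : Finset V, ∑ x ∈ s, f x v = ∑ x ∈ s, f v x := fun s =>
    sum_congr rfl fun x _ => hf x v
  simp only [huniv, sum_insert hA, sum_insert hvB, sum_add_distrib, hf0, e1, e2]
  ring

theorem IsBridgelessConnected.le_sum_recipTransmission (n : ℕ) :
    ∀ {V : Type} [Fintype V] [DecidableEq V] {G : SimpleGraph V}, G.IsBridgelessConnected →
      Fintype.card V = n →
      n * cycleProfile (n - 1) ≤ ∑ u, G.recipTransmission u ∧
      ((∃ u, 2 < (G.neighborSet u).ncard) →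
        n * cycleProfile (n - 1) < ∑ u, G.recipTransmission u) := by
  induction n using Nat.strong_induction_on with
  | _ n ih =>
  intro V _ _ G hG hn
  by_cases hsep : ∃ v A, G.IsSeparation v A
  · suffices n * cycleProfile (n - 1) < ∑ u, G.recipTransmission u from ⟨this.le, fun _ => this⟩
    obtain ⟨v, A, h⟩ := hsep
    have h' := h.compl
    set B := Aᶜ.erase v with hB
    have hbA := h.isBridgelessConnected_induce hG
    have hbB := h'.isBridgelessConnected_induce hG
    have hcard : #A + #B + 1 = n := by
      have h1 := card_erase_add_one (s := Aᶜ) (a := v) (by simpa using h.1)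
      rw [← hB] at h1
      have h2 := card_add_card_compl A
      omega
    have hA2 : 2 ≤ #A := h.two_le_card hG
    have hB2 : 2 ≤ #B := h'.two_le_card hG
    have hcA : Fintype.card ((insert v A : Finset V) : Set V) = #A + 1 := by
      simp [card_insert_of_notMem h.1]
    have hcB : Fintype.card ((insert v B : Finset V) : Set V) = #B + 1 := by
      simp [card_insert_of_notMem h'.1]
    have iA := (ih (#A + 1) (by omega) hbA hcA).1.trans (hG.1.sum_recipTransmission_induce_le hbA.1)
    have iB := (ih (#B + 1) (by omega) hbB hcB).1.trans (hG.1.sum_recipTransmission_induce_le hbB.1)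
    have hcross : crossProfile #A #B ≤ ∑ x ∈ A, ∑ y ∈ B, (1 : ℝ) / (G.dist x y : ℝ) := by
      refine (crossProfile_le (d := G.dist v) (h.succ_le_card_filter hG)
        (h'.succ_le_card_filter hG) ?_).trans ?_
      · intro x hx
        exact hG.1.pos_dist_of_ne (by rintro rfl; exact h.1 hx)
      · refine sum_le_sum fun x hx => sum_le_sum fun y hy => ?_
        have hxy : x ≠ y := by
          rintro rfl
          simp [hB, hx] at hy
        have h1 := hG.1.pos_dist_of_ne hxy
        have h2 := hG.1.dist_triangle (u := x) (v := v) (w := y)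
        rw [dist_comm (u := x) (v := v)] at h2
        gcongr
    have hglue := gluingBound hA2 hB2
    unfold GluingBound at hglue
    have hsum := sum_sum_eq_of_cut (f := fun x y => (1 : ℝ) / (G.dist x y : ℝ))
      (fun x y => by rw [dist_comm]) (fun x => by simp) h.1 hB
    simp only [recipTransmission] at iA iB ⊢
    rw [hsum]
    simp only [Nat.add_sub_cancel] at iA iB
    rw [← hcard, Nat.add_sub_cancel]
    push_cast at iA iB hglue ⊢
    linarith
  · push Not at hsep
    have hconst : (n : ℝ) * cycleProfile (n - 1) = ∑ _u : V, cycleProfile (n - 1) := by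
      simp [hn]
    rw [hconst, ← hn]
    refine ⟨sum_le_sum fun u _ => hG.1.cycleProfile_le_recipTransmission hsep u, ?_⟩
    rintro ⟨u, hu⟩
    exact sum_lt_sum (fun u _ => hG.1.cycleProfile_le_recipTransmission hsep u)
      ⟨u, mem_univ u, hG.1.cycleProfile_lt_recipTransmission hsep hu⟩

end Induction

theorem Iso.dist_eq {V W : Type*} {G : SimpleGraph V} {H : SimpleGraph W} (φ : G ≃g H)
    (hG : G.Connected) (x y : V) : H.dist (φ x) (φ y) = G.dist x y := by
  have hH : H.Connected := φ.connected_iff.mp hG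
  apply le_antisymm
  · obtain ⟨p, hp⟩ := hG.exists_walk_length_eq_dist x y
    rw [← hp, ← Walk.length_map φ.toHom p]
    exact dist_le _
  · obtain ⟨p, hp⟩ := hH.exists_walk_length_eq_dist (φ x) (φ y)
    rw [← hp, ← Walk.length_map φ.symm.toHom p]
    have : ∀ q : G.Walk (φ.symm (φ x)) (φ.symm (φ y)), G.dist x y ≤ q.length := by
      rw [φ.symm_apply_apply, φ.symm_apply_apply]
      exact fun q => dist_le q
    exact this _

theorem nonempty_iso_cycleGraph {n : ℕ} {G : SimpleGraph (Fin n)} (hn : 2 < n)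
    (hG : G.Connected) (hdeg : ∀ v, (G.neighborSet v).ncard = 2) :
    Nonempty (G ≃g cycleGraph n) := by
  have hcyc : G.IsCycles := fun v _ => hdeg v
  let v : Fin n := ⟨0, by omega⟩
  obtain ⟨p, hp, hverts⟩ := hcyc.exists_cycle_toSubgraph_verts_eq_connectedComponentSupp
    (v := v) (c := G.connectedComponentMk v) rfl
    (Set.nonempty_of_ncard_ne_zero (by rw [hdeg]; norm_num))
  have hsupp : ∀ w, w ∈ p.support := by
    intro w
    rw [← Walk.mem_verts_toSubgraph, hverts]
    exact ConnectedComponent.sound (hG.preconnected w v)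
  have hlen : p.length = n := by
    have h1 : p.IsHamiltonianCycle := by
      rw [Walk.isHamiltonianCycle_isCycle_and_isHamiltonian_tail]
      refine ⟨hp, hp.isPath_tail.isHamiltonian_of_mem fun w => ?_⟩
      rw [Walk.support_tail_of_not_nil p hp.not_nil]
      rcases (Walk.mem_support_iff p).mp (hsupp w) with rfl | hw
      · exact Walk.end_mem_tail_support hp.not_nil
      · exact hw
    simpa using h1.length_eq
  obtain ⟨⟨f, hf⟩⟩ := (cycleGraph_isContained_iff hn).mpr ⟨v, p, hp, hlen⟩
  have hbij : Function.Bijective f := Finite.injective_iff_bijective.mp hf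
  obtain ⟨m, rfl⟩ : ∃ m, n = m + 3 := ⟨n - 3, by omega⟩
  have himg : ∀ x, f '' (cycleGraph (m + 3)).neighborSet x = G.neighborSet (f x) := by
    intro x
    refine Set.eq_of_subset_of_ncard_le ?_ ?_ (Set.toFinite _)
    · rintro _ ⟨y, hy, rfl⟩
      exact f.map_adj hy
    · rw [hdeg, Set.ncard_image_of_injective _ hf, ← cycleGraph_degree_three_le (v := x),
        Set.ncard_eq_toFinset_card']
      exact le_rfl
  refine ⟨RelIso.symm ⟨Equiv.ofBijective f hbij, ?_⟩⟩
  intro x y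
  refine ⟨fun h => ?_, fun h => f.map_adj h⟩
  have hmem : f y ∈ G.neighborSet (f x) := h
  rw [← himg] at hmem
  obtain ⟨z, hz, hzy⟩ := hmem
  rwa [← hf hzy]

end SimpleGraph

theorem sum_recipTransmission_eq_two_mul_hararyIndex {n : ℕ} (G : SimpleGraph (Fin n)) :
    ∑ u, G.recipTransmission u = 2 * hararyIndex G := by
  set f : Fin n × Fin n → ℝ := fun p => 1 / (G.dist p.1 p.2 : ℝ) with hf
  have hsum : ∑ u, G.recipTransmission u = ∑ p, f p := by
    rw [Fintype.sum_prod_type]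
    rfl
  have hlt : ∑ p with p.1 < p.2, f p = hararyIndex G := rfl
  have hgt : ∑ p with p.2 < p.1, f p = hararyIndex G := by
    rw [← hlt]
    refine sum_equiv (Equiv.prodComm _ _) (by simp) fun p _ => ?_
    simp [hf, dist_comm]
  have hge : ∑ p with ¬p.1 < p.2, f p = ∑ p with p.2 < p.1, f p := by
    symm
    refine sum_subset (fun p => by simp; exact le_of_lt) fun p hp hp' => ?_
    simp only [mem_filter, mem_univ, true_and, not_lt] at hp hp'
    simp [hf, le_antisymm hp' hp]
  rw [hsum, ← sum_filter_add_sum_filter_not univ fun p : Fin n × Fin n => p.1 < p.2, hge, hgt,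
    hlt]
  ring

theorem hararyIndex_eq_of_iso {n : ℕ} {G H : SimpleGraph (Fin n)} (φ : G ≃g H)
    (hG : G.Connected) : hararyIndex G = hararyIndex H := by
  have : ∑ u, G.recipTransmission u = ∑ u, H.recipTransmission u := by
    rw [← φ.toEquiv.sum_comp fun u => H.recipTransmission u]
    refine sum_congr rfl fun u _ => ?_
    unfold SimpleGraph.recipTransmission
    rw [← φ.toEquiv.sum_comp fun x => (1 : ℝ) / (H.dist (φ.toEquiv u) x : ℝ)]
    refine sum_congr rfl fun x _ => ?_
    rw [← φ.dist_eq hG u x]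
    rfl
  rw [sum_recipTransmission_eq_two_mul_hararyIndex,
    sum_recipTransmission_eq_two_mul_hararyIndex] at this
  linarith

theorem ncard_neighborSet_cycleGraph_le {n : ℕ} (v : Fin n) :
    ((cycleGraph n).neighborSet v).ncard ≤ 2 := by
  match n with
  | 0 => exact v.elim0
  | 1 => simp [cycleGraph_one_eq_bot]
  | n + 2 =>
    rw [cycleGraph_neighborSet]
    exact (Set.ncard_insert_le _ _).trans (by simp)

theorem TwoEdgeConnected.isBridgelessConnected {n : ℕ} {G : SimpleGraph (Fin n)}
    (h : TwoEdgeConnected G) : G.IsBridgelessConnected := by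
  refine ⟨h.1, fun e => ?_⟩
  by_cases he : e ∈ G.edgeSet
  · exact h.2 e he
  · rw [SimpleGraph.deleteEdges_eq_self.mpr (by simpa using he)]
    exact h.1

/-- For every 2-edge-connected graph `G` on `n` vertices, `H(G) ≥ H(C_n)`,
with equality iff `G ≅ C_n`. -/
theorem harary_ge_of_twoEdgeConnected {n : ℕ} (G : SimpleGraph (Fin n))
    (h : TwoEdgeConnected G) :
    hararyIndex (cycleGraph n) ≤ hararyIndex G ∧
      (hararyIndex G = hararyIndex (cycleGraph n) ↔
        Nonempty (G ≃g cycleGraph n)) := by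
  have hG := h.isBridgelessConnected
  obtain ⟨hle, hlt⟩ := hG.le_sum_recipTransmission n (Fintype.card_fin n)
  rw [sum_recipTransmission_eq_two_mul_hararyIndex] at hle hlt
  have hne : Nonempty (Fin n) := hG.1.nonempty
  have hn : 0 < n := Fin.pos_iff_nonempty.mpr hne
  have hC : (cycleGraph n).Connected := Connected.mk cycleGraph_preconnected
  have hcyc : 2 * hararyIndex (cycleGraph n) ≤ n * cycleProfile (n - 1) := by
    rw [← sum_recipTransmission_eq_two_mul_hararyIndex]
    refine (sum_le_sum fun u _ =>
      hC.recipTransmission_le ncard_neighborSet_cycleGraph_le u).trans ?_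
    simp
  refine ⟨by linarith, fun heq => ?_, fun ⟨φ⟩ => hararyIndex_eq_of_iso φ hG.1⟩
  obtain rfl | hn1 := (show 1 ≤ n from hn).eq_or_lt
  · rw [Subsingleton.elim G (cycleGraph 1)]
    exact ⟨RelIso.refl _⟩
  have : Nontrivial (Fin n) := Fin.nontrivial_iff_two_le.mpr hn1
  have hdeg : ∀ v, (G.neighborSet v).ncard = 2 := by
    intro v
    apply le_antisymm
    · by_contra! hv
      have := hlt ⟨v, hv⟩
      linarith
    · obtain ⟨w, w', hww, hw, hw'⟩ := hG.exists_two_adj v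
      rw [← Set.ncard_pair hww]
      exact Set.ncard_le_ncard (by rintro x (rfl | rfl) <;> assumption) (Set.toFinite _)
  refine nonempty_iso_cycleGraph ?_ hG.1 hdeg
  obtain ⟨w, w', hww, hw, hw'⟩ := hG.exists_two_adj ⟨0, hn⟩
  have := card_le_univ ({⟨0, hn⟩, w, w'} : Finset (Fin n))
  rw [card_eq_three.mpr ⟨_, w, w', hw.ne, hw'.ne, hww, rfl⟩, Fintype.card_fin] at this
  omega
end

section
/- For every Eulerian graph G of order n, the Harary index H(G) is at least H(C_n), with equality if and only if G ≅ C_n. -/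
open SimpleGraph Finset

/-- The sum of reciprocal distances from a fixed vertex of a cycle of length `m + 1`. -/
noncomputable def cycleTransmission (m : ℕ) : ℝ :=
  ∑ i ∈ range m, (1 : ℝ) / ((i / 2 + 1 : ℕ) : ℝ)

/-- The mixed second difference of `m ↦ m * cycleTransmission (m - 1)`. -/
noncomputable def evenTerm (i j : ℕ) : ℝ :=
  if Even (i + j) then 4 / ((i + j + 2 : ℕ) : ℝ) else 0

lemma cycleTransmission_second_difference (i j : ℕ) :
    evenTerm i j =
      ((i + j + 3 : ℕ) : ℝ) * cycleTransmission (i + j + 2)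
        - 2 * (((i + j + 2 : ℕ) : ℝ) * cycleTransmission (i + j + 1))
        + ((i + j + 1 : ℕ) : ℝ) * cycleTransmission (i + j) := by
  unfold evenTerm cycleTransmission
  generalize i + j = s
  rw [sum_range_succ, sum_range_succ]
  generalize ∑ i ∈ range s, (1 : ℝ) / ((i / 2 + 1 : ℕ) : ℝ) = S
  rcases Nat.even_or_odd' s with ⟨k, rfl | rfl⟩
  · have h1 : 2 * k / 2 = k := by omega
    have h2 : (2 * k + 1) / 2 = k := by omega
    rw [if_pos (even_two_mul k), h1, h2]
    push_cast
    field_simp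
    ring
  · have h1 : (2 * k + 1) / 2 = k := by omega
    have h2 : (2 * k + 1 + 1) / 2 = k + 1 := by omega
    rw [if_neg (by simp), h1, h2]
    push_cast
    field_simp
    ring

lemma sum_evenTerm (p q : ℕ) :
    ∑ i ∈ range p, ∑ j ∈ range q, evenTerm i j =
      ((p + q + 1 : ℕ) : ℝ) * cycleTransmission (p + q)
        - ((p + 1 : ℕ) : ℝ) * cycleTransmission p
        - ((q + 1 : ℕ) : ℝ) * cycleTransmission q := by
  have row (i : ℕ) : ∑ j ∈ range q, evenTerm i j =
      (((i + q + 2 : ℕ) : ℝ) * cycleTransmission (i + q + 1)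
        - ((i + q + 1 : ℕ) : ℝ) * cycleTransmission (i + q))
      - (((i + 2 : ℕ) : ℝ) * cycleTransmission (i + 1)
        - ((i + 1 : ℕ) : ℝ) * cycleTransmission i) := by
    induction q with
    | zero => simp
    | succ q ih =>
      rw [sum_range_succ, ih, cycleTransmission_second_difference]
      simp only [← add_assoc]
      ring_nf
  induction p with
  | zero => simp [cycleTransmission]
  | succ p ih =>
    rw [sum_range_succ, ih, row]
    have h1 : p + 1 + q = p + q + 1 := by ring
    simp only [h1]
    push_cast
    ring

/-- Twice the reciprocal distance between the `i`-th and `j`-th closest vertices on either side of a cut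
vertex, in the worst case, minus the corresponding contribution of a cycle. -/
noncomputable def cutExcess (i j : ℕ) : ℝ :=
  2 / ((max 1 i + max 1 j : ℕ) : ℝ) - evenTerm i j

lemma cutExcess_comm (i j : ℕ) : cutExcess i j = cutExcess j i := by
  unfold cutExcess evenTerm
  simp only [add_comm]

lemma cutExcess_add_cutExcess_succ_nonneg {i : ℕ} (hi : 1 ≤ i) (j : ℕ) :
    0 ≤ cutExcess i j + cutExcess (i + 1) j := by
  have h0 : max 1 i = i := by omega
  have h1 : max 1 (i + 1) = i + 1 := by omega
  obtain ⟨b, hb, hb1, hbj⟩ : ∃ b, b = max 1 j ∧ 1 ≤ b ∧ b ≤ j + 1 := ⟨_, rfl, by omega, by omega⟩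
  have key (s : ℕ) (hs : i + j + 2 ≤ s) :
      (4 : ℝ) / (s : ℝ) ≤ 2 / ((i + b : ℕ) : ℝ) + 2 / ((i + 1 + b : ℕ) : ℝ) := by
    have e : (4 : ℝ) / (s : ℝ) = 2 / (s : ℝ) + 2 / (s : ℝ) := by ring
    have h2 : ((i + b : ℕ) : ℝ) ≤ s := by exact_mod_cast (by omega : i + b ≤ s)
    have h3 : ((i + 1 + b : ℕ) : ℝ) ≤ s := by exact_mod_cast (by omega : i + 1 + b ≤ s)
    have h4 : (0 : ℝ) < ((i + b : ℕ) : ℝ) := by exact_mod_cast (by omega : 0 < i + b)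
    have h5 : (0 : ℝ) < ((i + 1 + b : ℕ) : ℝ) := by positivity
    rw [e]
    gcongr
  unfold cutExcess evenTerm
  rw [h0, h1, ← hb]
  by_cases he : Even (i + j)
  · have ho : ¬ Even (i + 1 + j) := by
      rw [add_right_comm, Nat.even_add_one]; exact not_not.2 he
    rw [if_pos he, if_neg ho]
    linarith [key _ le_rfl]
  · have ho : Even (i + 1 + j) := by
      rw [add_right_comm, Nat.even_add_one]; exact he
    rw [if_neg he, if_pos ho]
    linarith [key (i + 1 + j + 2) (by omega)]

lemma sum_cutExcess_add_two_left {p : ℕ} (hp : 1 ≤ p) (q : ℕ) :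
    ∑ i ∈ range p, ∑ j ∈ range q, cutExcess i j ≤
      ∑ i ∈ range (p + 2), ∑ j ∈ range q, cutExcess i j := by
  rw [sum_range_succ, sum_range_succ, add_assoc, ← sum_add_distrib]
  exact le_add_of_nonneg_right
    (sum_nonneg fun j _ ↦ cutExcess_add_cutExcess_succ_nonneg hp j)

lemma sum_cutExcess_add_two_right (p : ℕ) {q : ℕ} (hq : 1 ≤ q) :
    ∑ i ∈ range p, ∑ j ∈ range q, cutExcess i j ≤
      ∑ i ∈ range p, ∑ j ∈ range (q + 2), cutExcess i j := by
  rw [sum_comm, sum_comm (s := range p)]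
  simp only [cutExcess_comm]
  simpa only [cutExcess_comm] using sum_cutExcess_add_two_left hq p

lemma sum_cutExcess_pos {p q : ℕ} (hp : 2 ≤ p) (hq : 2 ≤ q) :
    0 < ∑ i ∈ range p, ∑ j ∈ range q, cutExcess i j := by
  induction p using Nat.strong_induction_on with
  | _ p ihp =>
    by_cases hp4 : 4 ≤ p
    · obtain ⟨p, rfl⟩ : ∃ p', p = p' + 2 := ⟨p - 2, by omega⟩
      exact (ihp p (by omega) (by omega)).trans_le (sum_cutExcess_add_two_left (by omega) q)
    clear ihp
    induction q using Nat.strong_induction_on with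
    | _ q ihq =>
      by_cases hq4 : 4 ≤ q
      · obtain ⟨q, rfl⟩ : ∃ q', q = q' + 2 := ⟨q - 2, by omega⟩
        exact (ihq q (by omega) (by omega)).trans_le (sum_cutExcess_add_two_right p (by omega))
      clear ihq
      have : p = 2 ∨ p = 3 := by omega
      have : q = 2 ∨ q = 3 := by omega
      rcases ‹p = 2 ∨ p = 3› with rfl | rfl <;> rcases ‹q = 2 ∨ q = 3› with rfl | rfl <;>
        norm_num [sum_range_succ, cutExcess, evenTerm, Nat.even_iff]

/-- The reciprocal distances across a cut vertex strictly outweigh the corresponding part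
of the Harary index of a cycle. -/
lemma lt_sum_inv_max_add_max {p q : ℕ} (hp : 2 ≤ p) (hq : 2 ≤ q) :
    ((p + q + 1 : ℕ) : ℝ) * cycleTransmission (p + q) <
      ((p + 1 : ℕ) : ℝ) * cycleTransmission p + ((q + 1 : ℕ) : ℝ) * cycleTransmission q
        + ∑ i ∈ range p, ∑ j ∈ range q, 2 / ((max 1 i + max 1 j : ℕ) : ℝ) := by
  have h := sum_cutExcess_pos hp hq
  simp only [cutExcess, sum_sub_distrib] at h
  rw [sum_evenTerm] at h
  linarith

lemma sum_one_div_min (m : ℕ) :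
    ∑ j ∈ range m, (1 : ℝ) / ((min (j + 1) (m - j) : ℕ) : ℝ) = cycleTransmission m := by
  unfold cycleTransmission
  symm
  have hinj : Set.InjOn (fun i ↦ if i % 2 = 0 then i / 2 else m - 1 - i / 2) (range m : Set ℕ) := by
    intro a ha b hb hab
    simp only [coe_range, Set.mem_Iio] at ha hb
    dsimp only at hab
    split_ifs at hab <;> omega
  have hmaps : Set.MapsTo (fun i ↦ if i % 2 = 0 then i / 2 else m - 1 - i / 2)
      (range m : Set ℕ) (range m : Set ℕ) := by
    intro a ha
    simp only [coe_range, Set.mem_Iio] at ha ⊢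
    split_ifs <;> omega
  refine sum_nbij (fun i ↦ if i % 2 = 0 then i / 2 else m - 1 - i / 2) hmaps hinj
    (Finset.surjOn_of_injOn_of_card_le _ hmaps hinj le_rfl) fun i hi ↦ ?_
  rw [mem_range] at hi
  congr 2
  split_ifs <;> omega

/-- If every value of `f` is bounded in terms of the number of smaller values, then so is
the sequence of values of `f` in increasing order. -/
lemma exists_equiv_fin_le {α : Type*} [Fintype α] (f : α → ℕ) {b : ℕ → ℕ} (hb : Monotone b)
    (h : ∀ x, f x ≤ b #{y | f y < f x}) :
    ∃ e : Fin (Fintype.card α) ≃ α, ∀ i, f (e i) ≤ b i := by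
  classical
  let e₀ := (Fintype.equivFin α).symm
  let e := (Tuple.sort (f ∘ e₀)).trans e₀
  have hmono : Monotone (f ∘ e) := Tuple.monotone_sort (f ∘ e₀)
  refine ⟨e, fun i ↦ (h (e i)).trans (hb ?_)⟩
  calc #{y | f y < f (e i)} ≤ #((Finset.Iio i).map e.toEmbedding) := by
        refine card_le_card fun y hy ↦ ?_
        simp only [mem_filter, mem_univ, true_and] at hy
        refine mem_map.2 ⟨e.symm y, mem_Iio.2 ?_, by simp⟩
        by_contra hlt
        have := hmono (not_lt.1 hlt)
        simp only [Function.comp_apply, Equiv.apply_symm_apply] at this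
        omega
    _ = i := by simp

/-- If every value of `f` on `s` is bounded in terms of the number of smaller values, then sums of
an antitone function over the values of `f` can be bounded below. -/
lemma sum_range_le_sum_of_card_filter_lt {α : Type*} (s : Finset α) (f : α → ℕ) {b : ℕ → ℕ}
    (hb : Monotone b) (h : ∀ x ∈ s, f x ≤ b #{y ∈ s | f y < f x}) (g : ℕ → ℝ)
    (hg : ∀ x ∈ s, ∀ j, f x ≤ j → g j ≤ g (f x)) :
    ∑ i ∈ range #s, g (b i) ≤ ∑ x ∈ s, g (f x) := by
  obtain ⟨e, he⟩ := exists_equiv_fin_le (fun x : s ↦ f x) hb fun x ↦ by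
    refine (h x x.2).trans (hb (le_of_eq ?_))
    rw [← card_map (Function.Embedding.subtype (· ∈ s))]
    congr 1
    ext y
    simp
    tauto
  rw [← sum_coe_sort s, ← Equiv.sum_comp e, sum_range]
  have hs : Fintype.card s = #s := Fintype.card_coe s
  rw [← Equiv.sum_comp (finCongr hs)]
  exact sum_le_sum fun i _ ↦ hg _ (e i).2 _ (he i)

/-- Twice the Harary index, as a sum over ordered pairs of vertices. -/
noncomputable def orderedHararyIndex {V : Type*} [Fintype V] (G : SimpleGraph V) : ℝ :=
  ∑ u, ∑ v, (1 : ℝ) / (G.dist u v)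

lemma orderedHararyIndex_eq_two_mul {n : ℕ} (G : SimpleGraph (Fin n)) :
    orderedHararyIndex G = 2 * hararyIndex G := by
  have hswap : ∑ p : Fin n × Fin n with p.2 < p.1, (1 : ℝ) / (G.dist p.1 p.2) =
      hararyIndex G := by
    refine sum_equiv (Equiv.prodComm _ _) (by simp) fun p _ ↦ ?_
    simp [dist_comm]
  unfold orderedHararyIndex
  rw [← Fintype.sum_prod_type' (f := fun u v ↦ (1 : ℝ) / (G.dist u v)),
    ← sum_filter_add_sum_filter_not _ (fun p : Fin n × Fin n ↦ p.1 < p.2), two_mul]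
  congr 1
  rw [← hswap]
  symm
  refine sum_subset (fun p ↦ ?_) fun p h1 h2 ↦ ?_
  · simpa using fun h ↦ h.le
  · simp only [mem_filter, mem_univ, true_and, not_lt] at h1 h2
    rw [le_antisymm h2 h1]
    simp

lemma dist_iso_le {V W : Type*} {G : SimpleGraph V} {H : SimpleGraph W} (φ : G ≃g H)
    (hG : G.Connected) (u v : V) : H.dist (φ u) (φ v) ≤ G.dist u v := by
  obtain ⟨p, hp⟩ := hG.exists_walk_length_eq_dist u v
  simpa [hp] using dist_le (p.map φ.toHom)

lemma orderedHararyIndex_congr {V W : Type*} [Fintype V] [Fintype W] {G : SimpleGraph V}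
    {H : SimpleGraph W} (φ : G ≃g H) (hG : G.Connected) :
    orderedHararyIndex G = orderedHararyIndex H := by
  have hdist (u v : V) : H.dist (φ u) (φ v) = G.dist u v := by
    refine le_antisymm (dist_iso_le φ hG u v) ?_
    simpa using dist_iso_le φ.symm (φ.connected_iff.1 hG) (φ u) (φ v)
  unfold orderedHararyIndex
  rw [← Equiv.sum_comp φ.toEquiv]
  refine sum_congr rfl fun u _ ↦ ?_
  rw [← Equiv.sum_comp φ.toEquiv]
  exact sum_congr rfl fun v _ ↦ by simp [hdist]

lemma cycleGraph_min_le_length {n : ℕ} {u v : Fin n} (p : (cycleGraph n).Walk u v) :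
    min (v - u).val (n - (v - u).val) ≤ p.length := by
  induction p with
  | nil =>
    rename_i u
    have : NeZero n := ⟨by have := u.isLt; omega⟩
    simp
  | @cons u v w hadj p ih =>
    rw [Walk.length_cons]
    rw [cycleGraph_adj'] at hadj
    have hu := u.isLt
    have hv := v.isLt
    have hw := w.isLt
    simp only [Fin.sub_def] at hadj ih ⊢
    have key (a b : ℕ) (ha : a < n) (hb : b < n) :
        (n - b + a) % n = if b ≤ a then a - b else n - b + a := by
      split_ifs with h
      · rw [show n - b + a = (a - b) + n by omega, Nat.add_mod_right, Nat.mod_eq_of_lt (by omega)]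
      · exact Nat.mod_eq_of_lt (by omega)
    rw [key _ _ hw hv] at ih
    rw [key _ _ hu hv, key _ _ hv hu] at hadj
    rw [key _ _ hw hu]
    split_ifs at * <;> omega

lemma orderedHararyIndex_cycleGraph_le (n : ℕ) :
    orderedHararyIndex (cycleGraph (n + 1)) ≤ ((n + 1 : ℕ) : ℝ) * cycleTransmission n := by
  have row (u : Fin (n + 1)) :
      ∑ v, (1 : ℝ) / ((cycleGraph (n + 1)).dist u v) ≤ cycleTransmission n := by
    have h1 : ∑ v, (1 : ℝ) / ((cycleGraph (n + 1)).dist u v) ≤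
        ∑ v : Fin (n + 1), (1 : ℝ) / ((min (v - u).val (n + 1 - (v - u).val) : ℕ) : ℝ) := by
      refine sum_le_sum fun v _ ↦ ?_
      rcases eq_or_ne v u with rfl | hvu
      · simp
      obtain ⟨p, hp⟩ := cycleGraph_connected.exists_walk_length_eq_dist u v
      have hmin := cycleGraph_min_le_length p
      rw [hp] at hmin
      have h0 : (v - u).val ≠ 0 := fun h ↦ hvu (sub_eq_zero.1 (Fin.ext h))
      have hlt := (v - u).isLt
      have hpos : 0 < min (v - u).val (n + 1 - (v - u).val) := by omega
      gcongr
    refine h1.trans_eq ?_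
    rw [← Equiv.sum_comp (Equiv.addRight u)]
    simp only [Equiv.coe_addRight, add_sub_cancel_right]
    rw [Fin.sum_univ_succ, ← sum_one_div_min, sum_range]
    simp only [Fin.val_zero, Nat.zero_min, Nat.cast_zero, div_zero, zero_add, Fin.val_succ,
      Nat.add_sub_add_right]
  unfold orderedHararyIndex
  refine (sum_le_sum fun u _ ↦ row u).trans_eq ?_
  simp

lemma nonempty_iso_cycleGraph {n : ℕ} (G : SimpleGraph (Fin n)) [DecidableRel G.Adj]
    (hn : 3 ≤ n) (hG : G.Connected) (hdeg : ∀ v, G.degree v = 2) :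
    Nonempty (G ≃g cycleGraph n) := by
  classical
  have hcyc : G.IsCycles := fun v _ ↦ by
    rw [Set.ncard_eq_toFinset_card', ← neighborFinset_def, card_neighborFinset_eq_degree, hdeg]
  let v₀ : Fin n := ⟨0, by omega⟩
  obtain ⟨p, hp, hverts⟩ := hcyc.exists_cycle_toSubgraph_verts_eq_connectedComponentSupp
    (c := G.connectedComponentMk v₀) (v := v₀) rfl (by
      rw [← Set.ncard_pos, Set.ncard_eq_toFinset_card', ← neighborFinset_def,
        card_neighborFinset_eq_degree, hdeg]
      norm_num)
  have hsupp (w : Fin n) : w ∈ p.support := by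
    rw [← Walk.mem_verts_toSubgraph, hverts]
    exact ConnectedComponent.sound (hG w v₀)
  have hlen3 := hp.three_le_length
  have hinj : Function.Injective fun i : Fin p.length ↦ p.getVert i := by
    intro i j hij
    have := hp.getVert_injOn' (by simp; omega) (by simp; omega) hij
    exact Fin.ext this
  have hsurj : Function.Surjective fun i : Fin p.length ↦ p.getVert i := by
    intro w
    obtain ⟨i, hi, hil⟩ := Walk.mem_support_iff_exists_getVert.1 (hsupp w)
    rcases hil.lt_or_eq with h | h
    · exact ⟨⟨i, h⟩, hi⟩
    · refine ⟨⟨0, by omega⟩, ?_⟩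
      rw [h, Walk.getVert_length] at hi
      simpa using hi
  have hlen : p.length = n := by
    simpa using Fintype.card_of_bijective ⟨hinj, hsurj⟩
  let e : Fin n ≃ Fin n := (finCongr hlen.symm).trans (Equiv.ofBijective _ ⟨hinj, hsurj⟩)
  have he (i : Fin n) : e i = p.getVert i := rfl
  have hle : cycleGraph n ≤ G.comap e := by
    intro i j hij
    have hstep (i j : Fin n) (h : (j - i).val = 1) : G.Adj (e i) (e j) := by
      have hi := i.isLt
      have hj := j.isLt
      rw [he, he]
      by_cases hlt : i.val + 1 < n
      · have : j.val = i.val + 1 := by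
          rw [Fin.sub_def] at h
          dsimp only at h
          by_cases hij : i.val ≤ j.val
          · rw [show n - i.val + j.val = (j.val - i.val) + n by omega, Nat.add_mod_right,
              Nat.mod_eq_of_lt (by omega)] at h
            omega
          · rw [Nat.mod_eq_of_lt (by omega)] at h
            omega
        rw [this]
        exact p.adj_getVert_succ (by omega)
      · have : j.val = 0 := by
          rw [Fin.sub_def] at h
          dsimp only at h
          by_cases hij : j.val + 1 = n
          · rw [show n - i.val + j.val = n by omega, Nat.mod_self] at h
            omega
          · rw [Nat.mod_eq_of_lt (by omega)] at h
            omega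
        have h1 := p.adj_getVert_succ (i := i) (by omega)
        rw [show i.val + 1 = p.length by omega, Walk.getVert_length] at h1
        rwa [this, Walk.getVert_zero]
    rw [cycleGraph_adj'] at hij
    rcases hij with h | h
    · exact (hstep j i h).symm
    · exact hstep i j h
  have heq : G.comap e = cycleGraph n := by
    refine le_antisymm (fun i j hij ↦ ?_) hle
    have hsub : (cycleGraph n).neighborFinset i ⊆ (G.comap e).neighborFinset i := fun k hk ↦ by
      rw [mem_neighborFinset] at hk ⊢
      exact hle hk
    have hcard : #((G.comap e).neighborFinset i) ≤ #((cycleGraph n).neighborFinset i) := by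
      have h1 : (cycleGraph n).degree i = 2 := by
        obtain ⟨m, rfl⟩ : ∃ m, n = m + 3 := ⟨n - 3, by omega⟩
        exact cycleGraph_degree_three_le
      rw [card_neighborFinset_eq_degree, card_neighborFinset_eq_degree, h1,
        ← (Iso.comap e G).degree_eq, hdeg]
    rw [← mem_neighborFinset, eq_of_subset_of_card_le hsub hcard, mem_neighborFinset]
    exact hij
  exact ⟨(heq ▸ Iso.comap e G : cycleGraph n ≃g G).symm⟩

lemma exists_adj_dist_eq {V : Type*} {G : SimpleGraph V} (hG : G.Connected) {c x : V} {k : ℕ}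
    (hx : G.dist c x = k + 1) : ∃ y, G.Adj y x ∧ G.dist c y = k := by
  obtain ⟨p, hp⟩ := hG.exists_walk_length_eq_dist c x
  have hnil : ¬ p.Nil := fun h ↦ by
    rw [← Walk.length_eq_zero_iff] at h
    omega
  have hadj := p.adj_penultimate hnil
  refine ⟨p.penultimate, hadj, le_antisymm ?_ ?_⟩
  · have := dist_le p.dropLast
    rw [Walk.length_dropLast] at this
    omega
  · have := hG.dist_triangle (u := c) (v := p.penultimate) (w := x)
    rw [dist_eq_one_iff_adj.2 hadj] at this
    omega

section Branch

variable {V : Type*} {G : SimpleGraph V} {c : V} {A : Finset V}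

lemma exists_mem_dist_eq (hG : G.Connected) (hA : ∀ x ∈ A, ∀ y, G.Adj y x → y = c ∨ y ∈ A)
    {x : V} (hx : x ∈ A) {j : ℕ} (hj : 1 ≤ j) (hjx : j ≤ G.dist c x) :
    ∃ y ∈ A, G.dist c y = j := by
  obtain ⟨k, hk⟩ : ∃ k, G.dist c x = j + k := ⟨_, (Nat.add_sub_of_le hjx).symm⟩
  induction k generalizing x with
  | zero => exact ⟨x, hx, hk⟩
  | succ k ih =>
    obtain ⟨y, hyx, hy⟩ := exists_adj_dist_eq hG (k := j + k) hk
    rcases hA x hx y hyx with rfl | hyA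
    · rw [dist_self] at hy
      omega
    · exact ih hyA (by omega) hy

lemma connected_induce_insert [DecidableEq V] (hG : G.Connected)
    (hA : ∀ x ∈ A, ∀ y, G.Adj y x → y = c ∨ y ∈ A) :
    (G.induce (↑(insert c A) : Set V)).Connected := by
  have hc : c ∈ (↑(insert c A) : Set V) := by simp
  have key (k : ℕ) : ∀ x : (↑(insert c A) : Set V), G.dist c x = k →
      (G.induce (↑(insert c A) : Set V)).Reachable x ⟨c, hc⟩ := by
    induction k with
    | zero =>
      intro x hx
      rw [hG.dist_eq_zero_iff] at hx
      have : x = ⟨c, hc⟩ := Subtype.ext hx.symm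
      rw [this]
    | succ k ih =>
      rintro ⟨x, hx⟩ hxk
      have hxA : x ∈ A := by
        rcases mem_insert.1 (mem_coe.1 hx) with rfl | h
        · simp at hxk
        · exact h
      obtain ⟨y, hyx, hy⟩ := exists_adj_dist_eq hG hxk
      have hyA : y ∈ (↑(insert c A) : Set V) := by simpa using hA x hxA y hyx
      refine Reachable.trans ?_ (ih ⟨y, hyA⟩ hy)
      exact Adj.reachable (induce_adj.2 hyx.symm)
  exact connected_iff_exists_forall_reachable _ |>.2 ⟨⟨c, hc⟩, fun x ↦ (key _ x rfl).symm⟩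

lemma even_degree_induce_insert [Fintype V] [DecidableEq V] [DecidableRel G.Adj] (heven : ∀ v, Even (G.degree v))
    (hA : ∀ x ∈ A, ∀ y, G.Adj y x → y = c ∨ y ∈ A) (v : (↑(insert c A) : Set V)) :
    Even ((G.induce (↑(insert c A) : Set V)).degree v) := by
  have hne (v : (↑(insert c A) : Set V)) (hv : v.1 ≠ c) :
      Even ((G.induce (↑(insert c A) : Set V)).degree v) := by
    have hvA : v.1 ∈ A := by
      have := v.2
      simp only [coe_insert, Set.mem_insert_iff, mem_coe] at this
      exact this.resolve_left hv
    have hsub : G.neighborSet v ⊆ (↑(insert c A) : Set V) := fun y hy ↦ by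
      simpa using hA _ hvA y hy.symm
    convert heven v using 1
    convert degree_induce_of_neighborSet_subset hsub
  by_cases hv : v.1 = c
  · by_contra hodd
    have h1 := (G.induce (↑(insert c A) : Set V)).even_card_odd_degree_vertices
    have h2 : ({w | Odd ((G.induce (↑(insert c A) : Set V)).degree w)} : Finset _) = {v} := by
      ext w
      simp only [mem_filter, mem_univ, true_and, mem_singleton]
      constructor
      · intro hw
        by_contra hwv
        exact Nat.not_even_iff_odd.2 hw (hne w fun h ↦ hwv (Subtype.ext (h.trans hv.symm)))
      · rintro rfl
        exact Nat.not_even_iff_odd.1 hodd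
    rw [h2] at h1
    simp at h1
  · exact hne v hv

lemma two_le_card_filter_adj [Fintype V] [DecidableEq V] [DecidableRel G.Adj] (hG : G.Connected)
    (heven : ∀ v, Even (G.degree v)) (hcA : c ∉ A) (hne : A.Nonempty)
    (hA : ∀ x ∈ A, ∀ y, G.Adj y x → y = c ∨ y ∈ A) : 2 ≤ #{y ∈ A | G.Adj c y} := by
  have hc : c ∈ (↑(insert c A) : Set V) := by simp
  obtain ⟨a, ha⟩ := hne
  have : Nontrivial (↑(insert c A) : Set V) :=
    ⟨⟨c, hc⟩, ⟨a, by simp [ha]⟩, fun h ↦ hcA (by rw [Subtype.mk.injEq] at h; rwa [h])⟩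
  have hpos := (connected_induce_insert hG hA).preconnected.degree_pos_of_nontrivial ⟨c, hc⟩
  have hev := even_degree_induce_insert heven hA ⟨c, hc⟩
  have hcard : (G.induce (↑(insert c A) : Set V)).degree ⟨c, hc⟩ ≤ #{y ∈ A | G.Adj c y} := by
    rw [← card_neighborFinset_eq_degree, ← card_map (Function.Embedding.subtype _)]
    refine card_le_card fun y hy ↦ ?_
    obtain ⟨⟨z, hz⟩, hzc, rfl⟩ := mem_map.1 hy
    rw [mem_neighborFinset] at hzc
    have hadj : G.Adj c z := hzc
    have : z ∈ A := (mem_insert.1 (mem_coe.1 hz)).resolve_left hadj.ne'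
    simp [this, hadj]
  obtain ⟨k, hk⟩ := hev
  omega

lemma dist_le_max_card_filter_lt [Fintype V] [DecidableEq V] [DecidableRel G.Adj] (hG : G.Connected)
    (heven : ∀ v, Even (G.degree v)) (hcA : c ∉ A)
    (hA : ∀ x ∈ A, ∀ y, G.Adj y x → y = c ∨ y ∈ A) {x : V} (hx : x ∈ A) :
    G.dist c x ≤ max 1 #{y ∈ A | G.dist c y < G.dist c x} := by
  have key (k : ℕ) (hk : k + 2 ≤ G.dist c x) : k + 2 ≤ #{y ∈ A | G.dist c y < k + 2} := by
    induction k with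
    | zero =>
      refine (two_le_card_filter_adj hG heven hcA ⟨x, hx⟩ hA).trans (card_le_card ?_)
      refine monotone_filter_right _ fun y _ hy ↦ ?_
      rw [dist_eq_one_iff_adj.2 hy]
      norm_num
    | succ k ih =>
      obtain ⟨y, hyA, hy⟩ := exists_mem_dist_eq hG hA hx (j := k + 2) (by omega) (by omega)
      have hlt : #{y ∈ A | G.dist c y < k + 2} < #{y ∈ A | G.dist c y < k + 1 + 2} := by
        refine card_lt_card ⟨monotone_filter_right _ fun z _ hz ↦ by omega, fun hsub ↦ ?_⟩
        have := hsub (mem_filter.2 ⟨hyA, by omega⟩)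
        rw [mem_filter] at this
        omega
      have := ih (by omega)
      omega
  rcases le_or_gt (G.dist c x) 1 with h | h
  · exact h.trans (le_max_left _ _)
  · obtain ⟨k, hk⟩ : ∃ k, G.dist c x = k + 2 := ⟨_, (Nat.sub_add_cancel h).symm⟩
    rw [hk]
    exact (key k hk.ge).trans (le_max_right _ _)

lemma orderedHararyIndex_induce_le {S : Finset V}
    (hS : (G.induce (↑S : Set V)).Connected) :
    orderedHararyIndex (G.induce (↑S : Set V)) ≤
      ∑ u ∈ S, ∑ v ∈ S, (1 : ℝ) / (G.dist u v) := by
  have hle (u v : (↑S : Set V)) :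
      (1 : ℝ) / ((G.induce (↑S : Set V)).dist u v) ≤ 1 / (G.dist u v) := by
    rcases eq_or_ne u v with rfl | huv
    · simp
    obtain ⟨p, hp⟩ := hS.exists_walk_length_eq_dist u v
    have h1 := dist_le (p.map (Embedding.induce (G := G) (↑S : Set V)).toHom)
    rw [Walk.length_map, hp] at h1
    have h1' : G.dist u v ≤ (G.induce (↑S : Set V)).dist u v := h1
    have hreach : G.Reachable u v :=
      (p.map (Embedding.induce (G := G) (↑S : Set V)).toHom).reachable
    have h2 := hreach.pos_dist_of_ne fun h ↦ huv (Subtype.ext h)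
    gcongr
  calc orderedHararyIndex (G.induce (↑S : Set V))
      ≤ ∑ u : (↑S : Set V), ∑ v : (↑S : Set V), (1 : ℝ) / (G.dist u v) :=
        sum_le_sum fun u _ ↦ sum_le_sum fun v _ ↦ hle u v
    _ = ∑ u ∈ S, ∑ v ∈ S, (1 : ℝ) / (G.dist u v) := by
        rw [← sum_coe_sort S]
        exact sum_congr rfl fun u _ ↦ sum_coe_sort S fun v ↦ (1 : ℝ) / (G.dist u v)

end Branch

/-- The reciprocal distances across a cut vertex are smallest when both sides are paths
with a doubled first vertex. -/
lemma sum_range_le_sum_cross {V : Type*} [Fintype V] [DecidableEq V] {G : SimpleGraph V}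
    [DecidableRel G.Adj] (hG : G.Connected) (heven : ∀ v, Even (G.degree v)) {c : V}
    {A B : Finset V} (hcA : c ∉ A) (hcB : c ∉ B) (hAB : Disjoint A B)
    (hA : ∀ x ∈ A, ∀ y, G.Adj y x → y = c ∨ y ∈ A)
    (hB : ∀ x ∈ B, ∀ y, G.Adj y x → y = c ∨ y ∈ B) :
    ∑ i ∈ range #A, ∑ j ∈ range #B, 2 / ((max 1 i + max 1 j : ℕ) : ℝ) ≤
      2 * ∑ u ∈ A, ∑ v ∈ B, (1 : ℝ) / (G.dist u v) := by
  have hb : Monotone fun i : ℕ ↦ max 1 i := fun i j h ↦ max_le_max le_rfl h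
  have hpos {D : Finset V} (hcD : c ∉ D) {x : V} (hx : x ∈ D) : 0 < G.dist c x :=
    hG.pos_dist_of_ne fun h ↦ hcD (h ▸ hx)
  calc ∑ i ∈ range #A, ∑ j ∈ range #B, 2 / ((max 1 i + max 1 j : ℕ) : ℝ)
      ≤ ∑ u ∈ A, ∑ j ∈ range #B, 2 / ((G.dist c u + max 1 j : ℕ) : ℝ) := by
        refine sum_range_le_sum_of_card_filter_lt A (G.dist c) hb
          (fun x hx ↦ dist_le_max_card_filter_lt hG heven hcA hA hx)
          (fun k ↦ ∑ j ∈ range #B, 2 / ((k + max 1 j : ℕ) : ℝ)) fun x hx k hk ↦ ?_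
        have := hpos hcA hx
        gcongr
    _ ≤ ∑ u ∈ A, ∑ v ∈ B, 2 / ((G.dist c u + G.dist c v : ℕ) : ℝ) := by
        refine sum_le_sum fun u hu ↦ ?_
        refine sum_range_le_sum_of_card_filter_lt B (G.dist c) hb
          (fun x hx ↦ dist_le_max_card_filter_lt hG heven hcB hB hx)
          (fun k ↦ 2 / ((G.dist c u + k : ℕ) : ℝ)) fun x hx k hk ↦ ?_
        have := hpos hcB hx
        gcongr
    _ ≤ ∑ u ∈ A, ∑ v ∈ B, 2 / (G.dist u v : ℝ) := by
        refine sum_le_sum fun u hu ↦ sum_le_sum fun v hv ↦ ?_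
        have h1 : 0 < G.dist u v :=
          hG.pos_dist_of_ne fun h ↦ disjoint_left.1 hAB hu (h ▸ hv)
        have h2 := hG.dist_triangle (u := u) (v := c) (w := v)
        rw [dist_comm (u := u) (v := c)] at h2
        gcongr
    _ = 2 * ∑ u ∈ A, ∑ v ∈ B, (1 : ℝ) / (G.dist u v) := by
        simp only [mul_sum]
        refine sum_congr rfl fun u _ ↦ sum_congr rfl fun v _ ↦ by ring

lemma orderedHararyIndex_eq_of_cut {V : Type*} [Fintype V] [DecidableEq V] (G : SimpleGraph V)
    {c : V} {A B : Finset V} (hcA : c ∉ A) (hcB : c ∉ B) (hAB : Disjoint A B)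
    (huniv : insert c (A ∪ B) = univ) :
    orderedHararyIndex G =
      ∑ u ∈ insert c A, ∑ v ∈ insert c A, (1 : ℝ) / (G.dist u v)
        + ∑ u ∈ insert c B, ∑ v ∈ insert c B, (1 : ℝ) / (G.dist u v)
        + 2 * ∑ u ∈ A, ∑ v ∈ B, (1 : ℝ) / (G.dist u v) := by
  have hc : c ∉ A ∪ B := by simp [hcA, hcB]
  have hBA : ∑ u ∈ B, ∑ v ∈ A, (1 : ℝ) / (G.dist u v) =
      ∑ u ∈ A, ∑ v ∈ B, (1 : ℝ) / (G.dist u v) := by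
    rw [sum_comm]
    simp only [dist_comm]
  unfold orderedHararyIndex
  simp only [← huniv, sum_insert hc, sum_insert hcA, sum_insert hcB, sum_union hAB,
    sum_add_distrib, dist_self, hBA]
  simp
  ring

lemma mul_cycleTransmission_lt_of_cut {V : Type*} [Fintype V] [DecidableEq V] {G : SimpleGraph V}
    [DecidableRel G.Adj] (hG : G.Connected) (heven : ∀ v, Even (G.degree v)) {c : V}
    {A B : Finset V} (hcA : c ∉ A) (hcB : c ∉ B) (hAB : Disjoint A B)
    (huniv : insert c (A ∪ B) = univ) (hAne : A.Nonempty) (hBne : B.Nonempty)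
    (hA : ∀ x ∈ A, ∀ y, G.Adj y x → y = c ∨ y ∈ A)
    (hB : ∀ x ∈ B, ∀ y, G.Adj y x → y = c ∨ y ∈ B)
    (ihA : ((#A + 1 : ℕ) : ℝ) * cycleTransmission #A ≤
      orderedHararyIndex (G.induce (↑(insert c A) : Set V)))
    (ihB : ((#B + 1 : ℕ) : ℝ) * cycleTransmission #B ≤
      orderedHararyIndex (G.induce (↑(insert c B) : Set V))) :
    ((#A + #B + 1 : ℕ) : ℝ) * cycleTransmission (#A + #B) < orderedHararyIndex G := by
  have h2 {D : Finset V} (hcD : c ∉ D) (hDne : D.Nonempty)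
      (hD : ∀ x ∈ D, ∀ y, G.Adj y x → y = c ∨ y ∈ D) : 2 ≤ #D :=
    (two_le_card_filter_adj hG heven hcD hDne hD).trans (card_filter_le _ _)
  rw [orderedHararyIndex_eq_of_cut G hcA hcB hAB huniv]
  have := lt_sum_inv_max_add_max (h2 hcA hAne hA) (h2 hcB hBne hB)
  have := sum_range_le_sum_cross hG heven hcA hcB hAB hA hB
  have := orderedHararyIndex_induce_le (connected_induce_insert hG hA)
  have := orderedHararyIndex_induce_le (connected_induce_insert hG hB)
  linarith

/-- If no vertex separates the graph, then every intermediate distance from `v` is attained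
at least twice. -/
lemma two_le_card_filter_dist_eq {V : Type*} [Fintype V] [DecidableEq V] {G : SimpleGraph V}
    (hG : G.Connected)
    (hcut : ∀ (c : V) (A B : Finset V), c ∉ A → c ∉ B → Disjoint A B → insert c (A ∪ B) = univ →
      A.Nonempty → B.Nonempty → ∃ x ∈ A, ∃ y ∈ B, G.Adj x y)
    {v x : V} {j : ℕ} (hj : 1 ≤ j) (hjx : j < G.dist v x) :
    2 ≤ #{y | G.dist v y = j} := by
  by_contra! hlt
  obtain ⟨c, -, hc⟩ := exists_mem_dist_eq (c := v) (A := univ.erase v) hG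
    (fun _ _ y _ ↦ by simpa using em _) (x := x) (by
      rw [mem_erase]
      exact ⟨fun h ↦ by subst h; simp at hjx, mem_univ _⟩) hj hjx.le
  have huniq (z : V) (hz : G.dist v z = j) : z = c :=
    card_le_one.1 (Nat.lt_succ_iff.1 hlt) z (by simp [hz]) c (by simp [hc])
  obtain ⟨a, ha, b, hb, hab⟩ := hcut c ({z | G.dist v z < j} : Finset V)
    ({z | z ≠ c ∧ j ≤ G.dist v z} : Finset V)
    (by simp [hc]) (by simp)
    (disjoint_left.2 fun z h1 h2 ↦ by
      simp only [mem_filter, mem_univ, true_and] at h1 h2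
      omega)
    (by
      ext z
      simp only [mem_insert, mem_union, mem_filter, mem_univ, true_and, iff_true]
      by_cases h : z = c
      · exact Or.inl h
      · exact Or.inr ((lt_or_ge _ _).imp_right fun h' ↦ ⟨h, h'⟩))
    ⟨v, by simpa using Nat.zero_lt_of_lt hj⟩
    ⟨x, by
      simp only [mem_filter, mem_univ, true_and]
      exact ⟨fun h ↦ by rw [h, hc] at hjx; omega, hjx.le⟩⟩
  simp only [mem_filter, mem_univ, true_and] at ha hb
  have := hG.dist_triangle (u := v) (v := a) (w := b)
  rw [dist_eq_one_iff_adj.2 hab] at this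
  exact hb.1 (huniq b (by omega))

lemma two_mul_le_card_filter_dist_lt {V : Type*} [Fintype V] [DecidableEq V] {G : SimpleGraph V}
    (hG : G.Connected)
    (hcut : ∀ (c : V) (A B : Finset V), c ∉ A → c ∉ B → Disjoint A B → insert c (A ∪ B) = univ →
      A.Nonempty → B.Nonempty → ∃ x ∈ A, ∃ y ∈ B, G.Adj x y)
    {v x : V} (k : ℕ) (hk : k < G.dist v x) :
    2 * k ≤ #{y ∈ univ.erase v | G.dist v y < k + 1} := by
  induction k with
  | zero => simp
  | succ k ih =>
    have h1 := ih (by omega)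
    have h2 := two_le_card_filter_dist_eq hG hcut (j := k + 1) (by omega) hk
    have hdisj : Disjoint ({y ∈ univ.erase v | G.dist v y < k + 1} : Finset V)
        ({y | G.dist v y = k + 1} : Finset V) := disjoint_left.2 fun z hz1 hz2 ↦ by
      simp only [mem_filter, mem_univ, true_and] at hz1 hz2
      omega
    calc 2 * (k + 1) ≤ _ + _ := by rw [mul_add]; exact add_le_add h1 h2
      _ = _ := (card_union_of_disjoint hdisj).symm
      _ ≤ _ := card_le_card fun z hz ↦ by
        simp only [mem_union, mem_filter, mem_erase, mem_univ, true_and, and_true] at hz ⊢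
        rcases hz with hz | hz
        · exact ⟨hz.1, by omega⟩
        · exact ⟨fun h ↦ by subst h; simp at hz, by omega⟩

lemma orderedHararyIndex_row_eq {V : Type*} [Fintype V] [DecidableEq V] (G : SimpleGraph V)
    (v : V) : ∑ x, (1 : ℝ) / (G.dist v x) = ∑ x ∈ univ.erase v, (1 : ℝ) / (G.dist v x) := by
  rw [← add_sum_erase univ _ (mem_univ v)]
  simp

/-- In a graph without cut vertices the reciprocal distances from a vertex are at least those in
a cycle. -/
lemma cycleTransmission_le_of_no_cut {V : Type*} [Fintype V] [DecidableEq V] {G : SimpleGraph V}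
    (hG : G.Connected)
    (hcut : ∀ (c : V) (A B : Finset V), c ∉ A → c ∉ B → Disjoint A B → insert c (A ∪ B) = univ →
      A.Nonempty → B.Nonempty → ∃ x ∈ A, ∃ y ∈ B, G.Adj x y) (v : V) :
    cycleTransmission (Fintype.card V - 1) ≤ ∑ x, (1 : ℝ) / (G.dist v x) := by
  have hcard : #(univ.erase v) = Fintype.card V - 1 := by
    rw [card_erase_of_mem (mem_univ v), card_univ]
  rw [orderedHararyIndex_row_eq, ← hcard]
  refine sum_range_le_sum_of_card_filter_lt (univ.erase v) (G.dist v) (b := fun i ↦ i / 2 + 1)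
    (fun i j h ↦ by dsimp only; omega) (fun x hx ↦ ?_) (fun k ↦ (1 : ℝ) / (k : ℝ))
    fun x hx j hj ↦ ?_
  · have h0 : 0 < G.dist v x := hG.pos_dist_of_ne (ne_of_mem_erase hx).symm
    obtain ⟨k, hk⟩ : ∃ k, G.dist v x = k + 1 := ⟨_, (Nat.sub_add_cancel h0).symm⟩
    have := two_mul_le_card_filter_dist_lt hG hcut (v := v) (x := x) k (by omega)
    rw [hk]
    omega
  · have h0 : 0 < G.dist v x := hG.pos_dist_of_ne (ne_of_mem_erase hx).symm
    gcongr

lemma cycleTransmission_lt_of_no_cut {V : Type*} [Fintype V] [DecidableEq V] {G : SimpleGraph V}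
    [DecidableRel G.Adj] (hG : G.Connected)
    (hcut : ∀ (c : V) (A B : Finset V), c ∉ A → c ∉ B → Disjoint A B → insert c (A ∪ B) = univ →
      A.Nonempty → B.Nonempty → ∃ x ∈ A, ∃ y ∈ B, G.Adj x y) {v : V} (hv : 2 < G.degree v) :
    cycleTransmission (Fintype.card V - 1) < ∑ x, (1 : ℝ) / (G.dist v x) := by
  have hcard : #(univ.erase v) = Fintype.card V - 1 := by
    rw [card_erase_of_mem (mem_univ v), card_univ]
  have hdeg : 2 < #{y ∈ univ.erase v | G.dist v y < 2} := by
    refine hv.trans_le (card_le_card fun y hy ↦ ?_)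
    rw [mem_neighborFinset] at hy
    simp [dist_eq_one_iff_adj.2 hy, hy.ne']
  rw [orderedHararyIndex_row_eq, ← hcard]
  refine lt_of_lt_of_le ?_ (sum_range_le_sum_of_card_filter_lt (univ.erase v) (G.dist v)
    (b := fun i ↦ if i = 2 then 1 else i / 2 + 1)
    (fun i j h ↦ by dsimp only; split_ifs <;> omega) (fun x hx ↦ ?_) (fun k ↦ (1 : ℝ) / (k : ℝ))
    fun x hx j hj ↦ ?_)
  · refine sum_lt_sum (fun i _ ↦ ?_) ⟨2, ?_, ?_⟩
    · split_ifs with h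
      · subst h
        norm_num
      · rfl
    · exact mem_range.2 (hdeg.trans_le (card_filter_le _ _))
    · norm_num
  · have h0 : 0 < G.dist v x := hG.pos_dist_of_ne (ne_of_mem_erase hx).symm
    obtain ⟨k, hk⟩ : ∃ k, G.dist v x = k + 1 := ⟨_, (Nat.sub_add_cancel h0).symm⟩
    have := two_mul_le_card_filter_dist_lt hG hcut (v := v) (x := x) k (by omega)
    rw [hk]
    split_ifs with h
    · have : k ≠ 1 := by
        rintro rfl
        simp only [Nat.reduceAdd] at h
        omega
      omega
    · omega
  · have h0 : 0 < G.dist v x := hG.pos_dist_of_ne (ne_of_mem_erase hx).symm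
    gcongr

/-- The Harary index of an Eulerian graph is at least that of a cycle, strictly so if some vertex
has degree more than two. -/
lemma mul_cycleTransmission_le_orderedHararyIndex {V : Type*} [Fintype V] (G : SimpleGraph V)
    [DecidableRel G.Adj] (hG : G.Connected) (heven : ∀ v, Even (G.degree v)) :
    (Fintype.card V : ℝ) * cycleTransmission (Fintype.card V - 1) ≤ orderedHararyIndex G ∧
      ∀ v, 2 < G.degree v →
        (Fintype.card V : ℝ) * cycleTransmission (Fintype.card V - 1) < orderedHararyIndex G := by
  classical
  induction hn : Fintype.card V using Nat.strong_induction_on generalizing V with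
  | _ n ih =>
  subst hn
  by_cases hcut : ∀ (c : V) (A B : Finset V), c ∉ A → c ∉ B → Disjoint A B →
      insert c (A ∪ B) = univ → A.Nonempty → B.Nonempty → ∃ x ∈ A, ∃ y ∈ B, G.Adj x y
  · have hconst : (Fintype.card V : ℝ) * cycleTransmission (Fintype.card V - 1) =
        ∑ _v : V, cycleTransmission (Fintype.card V - 1) := by simp
    rw [hconst]
    exact ⟨sum_le_sum fun v _ ↦ cycleTransmission_le_of_no_cut hG hcut v, fun v hv ↦
      sum_lt_sum (fun v _ ↦ cycleTransmission_le_of_no_cut hG hcut v)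
        ⟨v, mem_univ v, cycleTransmission_lt_of_no_cut hG hcut hv⟩⟩
  · push Not at hcut
    obtain ⟨c, A, B, hcA, hcB, hAB, huniv, hAne, hBne, hnadj⟩ := hcut
    have hcard : Fintype.card V = #A + #B + 1 := by
      rw [← card_univ, ← huniv, card_insert_of_notMem (by simp [hcA, hcB]),
        card_union_of_disjoint hAB]
    have hmem (y : V) : y = c ∨ y ∈ A ∨ y ∈ B := by
      simpa using huniv.ge (mem_univ y)
    have hA (x) (hx : x ∈ A) (y) (hyx : G.Adj y x) : y = c ∨ y ∈ A := by
      rcases hmem y with h | h | h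
      · exact Or.inl h
      · exact Or.inr h
      · exact absurd hyx.symm (hnadj x hx y h)
    have hB (x) (hx : x ∈ B) (y) (hyx : G.Adj y x) : y = c ∨ y ∈ B := by
      rcases hmem y with h | h | h
      · exact Or.inl h
      · exact absurd hyx (hnadj y h x hx)
      · exact Or.inr h
    have hD {D : Finset V} (hcD : c ∉ D) (hlt : #D + 1 < Fintype.card V)
        (hD : ∀ x ∈ D, ∀ y, G.Adj y x → y = c ∨ y ∈ D) :
        ((#D + 1 : ℕ) : ℝ) * cycleTransmission #D ≤
          orderedHararyIndex (G.induce (↑(insert c D) : Set V)) := by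
      have hcardD : Fintype.card (↑(insert c D) : Set V) = #D + 1 := by
        simp [card_insert_of_notMem hcD]
      simpa using (ih _ hlt (G.induce (↑(insert c D) : Set V))
        (connected_induce_insert hG hD) (even_degree_induce_insert heven hD) hcardD).1
    have hApos := hAne.card_pos
    have hBpos := hBne.card_pos
    have := mul_cycleTransmission_lt_of_cut hG heven hcA hcB hAB huniv hAne hBne hA hB
      (hD hcA (by omega) hA) (hD hcB (by omega) hB)
    rw [hcard, Nat.add_sub_cancel]
    exact ⟨this.le, fun _ _ ↦ this⟩

/-- For every Eulerian graph `G` of order `n`, `H(G) ≥ H(C_n)`,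
with equality iff `G ≅ C_n`. -/
theorem harary_ge_of_eulerian {n : ℕ} (G : SimpleGraph (Fin n))
    [DecidableRel G.Adj] (h : IsEulerian G) :
    hararyIndex (cycleGraph n) ≤ hararyIndex G ∧
      (hararyIndex G = hararyIndex (cycleGraph n) ↔
        Nonempty (G ≃g cycleGraph n)) := by
  obtain ⟨hG, heven⟩ := h
  have hn0 : n ≠ 0 := by
    rintro rfl
    exact hG.nonempty.elim fun v ↦ v.elim0
  obtain ⟨m, rfl⟩ : ∃ m, n = m + 1 := ⟨n - 1, by omega⟩
  have hcycle := orderedHararyIndex_cycleGraph_le m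
  obtain ⟨hle, hlt⟩ := mul_cycleTransmission_le_orderedHararyIndex G hG heven
  rw [Fintype.card_fin, Nat.add_sub_cancel] at hle hlt
  rw [orderedHararyIndex_eq_two_mul] at hcycle hle hlt
  refine ⟨by linarith, fun heq ↦ ?_, fun ⟨φ⟩ ↦ ?_⟩
  · rcases Nat.eq_zero_or_pos m with rfl | hm
    · have h1 : G = cycleGraph 1 := Subsingleton.elim (α := SimpleGraph (Fin 1)) _ _
      exact ⟨h1 ▸ Iso.refl⟩
    have : Nontrivial (Fin (m + 1)) := Fin.nontrivial_iff_two_le.2 (by omega)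
    have hdeg (v : Fin (m + 1)) : G.degree v = 2 := by
      have h1 : ¬ 2 < G.degree v := fun hv ↦ by
        have := hlt v hv
        linarith
      have h2 := hG.preconnected.degree_pos_of_nontrivial v
      obtain ⟨k, hk⟩ := heven v
      omega
    have hn : 3 ≤ m + 1 := by
      have := G.degree_lt_card_verts 0
      rwa [hdeg, Fintype.card_fin] at this
    exact nonempty_iso_cycleGraph G hn hG hdeg
  · have := orderedHararyIndex_congr φ hG
    rw [orderedHararyIndex_eq_two_mul, orderedHararyIndex_eq_two_mul] at this
    linarith
end
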